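/- arXiv:math/0309125 — 5 statements merged into one kernel-verified Lean document; each statement's English description precedes it below -/
import Mathlib

section
/- Let K be a field of characteristic 0 and let (u,v) ∈ K[x,y]² determine a birational morphism of the affine plane A² over K with deg u + deg v > 2 (degrees are total degrees). If this morphism is a product of simple affine contractions, then the sum of degrees can be decreased by a single generalized simple affine contraction: there exist a pair (u',v') obtained from (u,v) by one elementary transformation of type (ET1), (ET1'), (ET2), (ET2'), or (ET3) such that deg u' + deg v' < deg u + deg v. -/
/-- The elementary transformations (ET1), (ET1'), (ET2), (ET2'), (ET3) on pairs of
polynomials in `K[x,y]`.  In (ET1)/(ET1') the quotient is specified by the equation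
`quotient * denominator = numerator`, together with the divisibility condition. -/
def ElemTrans {K : Type*} [Field K]
    (p p' : MvPolynomial (Fin 2) K × MvPolynomial (Fin 2) K) : Prop :=
  -- (ET1) : (u, v) ↦ ((u + a)/(c·v + b), v)
  (∃ a b c : K, MvPolynomial.C c * p.2 + MvPolynomial.C b ≠ 0 ∧
      (MvPolynomial.C c * p.2 + MvPolynomial.C b) ∣ (p.1 + MvPolynomial.C a) ∧
      p'.1 * (MvPolynomial.C c * p.2 + MvPolynomial.C b) = p.1 + MvPolynomial.C a ∧
      p'.2 = p.2) ∨
  -- (ET1') : (u, v) ↦ (u, (v + a)/(c·u + b))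
  (∃ a b c : K, MvPolynomial.C c * p.1 + MvPolynomial.C b ≠ 0 ∧
      (MvPolynomial.C c * p.1 + MvPolynomial.C b) ∣ (p.2 + MvPolynomial.C a) ∧
      p'.2 * (MvPolynomial.C c * p.1 + MvPolynomial.C b) = p.2 + MvPolynomial.C a ∧
      p'.1 = p.1) ∨
  -- (ET2) : (u, v) ↦ (u + q(v), v)
  (∃ q : Polynomial K, p' = (p.1 + Polynomial.aeval p.2 q, p.2)) ∨
  -- (ET2') : (u, v) ↦ (u, v + q(u))
  (∃ q : Polynomial K, p' = (p.1, p.2 + Polynomial.aeval p.1 q)) ∨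
  -- (ET3) : (u, v) ↦ (v, u)
  p' = (p.2, p.1)
/-- The map `τ_x : x ↦ x, y ↦ xy`, as a `K`-algebra endomorphism of `K[x,y]`. -/
noncomputable def tauX (K : Type*) [Field K] :
    MvPolynomial (Fin 2) K →ₐ[K] MvPolynomial (Fin 2) K :=
  MvPolynomial.aeval ![MvPolynomial.X 0, MvPolynomial.X 0 * MvPolynomial.X 1]

/-- A simple affine contraction: a `K`-algebra endomorphism of `K[x,y]` that is either a
`K`-algebra automorphism or the map `τ_x : x ↦ x, y ↦ xy`. -/
def IsSimpleAffineContraction {K : Type*} [Field K]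
    (ψ : MvPolynomial (Fin 2) K →ₐ[K] MvPolynomial (Fin 2) K) : Prop :=
  (∃ e : MvPolynomial (Fin 2) K ≃ₐ[K] MvPolynomial (Fin 2) K, ψ = e) ∨ ψ = tauX K

/-- `φ` is a composition of finitely many simple affine contractions. -/
def IsProdOfSAC {K : Type*} [Field K]
    (φ : MvPolynomial (Fin 2) K →ₐ[K] MvPolynomial (Fin 2) K) : Prop :=
  ∃ L : List (MvPolynomial (Fin 2) K →ₐ[K] MvPolynomial (Fin 2) K),
    (∀ ψ ∈ L, IsSimpleAffineContraction ψ) ∧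
    φ = L.foldr AlgHom.comp (AlgHom.id K (MvPolynomial (Fin 2) K))
/-- The pair `(u, v)` determines a birational morphism of the affine plane: the subfield
`K(u, v)` of the rational function field `K(x, y)` generated over `K` by `u` and `v`
equals all of `K(x, y)`. -/
def IsBirationalPair {K : Type*} [Field K] (u v : MvPolynomial (Fin 2) K) : Prop :=
  IntermediateField.adjoin K
    {algebraMap (MvPolynomial (Fin 2) K) (FractionRing (MvPolynomial (Fin 2) K)) u,
     algebraMap (MvPolynomial (Fin 2) K) (FractionRing (MvPolynomial (Fin 2) K)) v} = ⊤


open MvPolynomial in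
/-- weight of an exponent -/
def wtE (w : Fin 2 → ℕ) (m : Fin 2 →₀ ℕ) : ℕ := m 0 * w 0 + m 1 * w 1

noncomputable def Th {K : Type*} [Field K] (w : Fin 2 → ℕ) :
    MvPolynomial (Fin 2) K →ₐ[K] Polynomial (MvPolynomial (Fin 2) K) :=
  MvPolynomial.aeval (fun i => Polynomial.C (MvPolynomial.X i) * Polynomial.X ^ (w i))

noncomputable def Dw {K : Type*} [Field K] (w : Fin 2 → ℕ) (f : MvPolynomial (Fin 2) K) : ℕ :=
  (Th w f).natDegree

noncomputable def ld {K : Type*} [Field K] (w : Fin 2 → ℕ) (f : MvPolynomial (Fin 2) K) :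
    MvPolynomial (Fin 2) K := (Th w f).leadingCoeff

section
variable {K : Type*} [Field K] (w : Fin 2 → ℕ)

lemma Th_monomial (m : Fin 2 →₀ ℕ) (a : K) :
    Th w (MvPolynomial.monomial m a) =
      Polynomial.monomial (wtE w m) (MvPolynomial.monomial m a) := by
  rw [Th, MvPolynomial.aeval_monomial, MvPolynomial.monomial_eq, ← Polynomial.C_mul_X_pow_eq_monomial]
  rw [Finsupp.prod_fintype _ _ (by simp), Finsupp.prod_fintype _ _ (by simp)]
  simp only [Fin.prod_univ_two, wtE, Polynomial.algebraMap_apply, MvPolynomial.algebraMap_eq, map_mul, map_pow]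
  ring

lemma Th_coeff_pderiv (i : Fin 2) (F : MvPolynomial (Fin 2) K) (n : ℕ) :
    (Th w (MvPolynomial.pderiv i F)).coeff n =
      MvPolynomial.pderiv i ((Th w F).coeff (n + w i)) := by
  induction F using MvPolynomial.induction_on' with
  | monomial m a =>
    rw [MvPolynomial.pderiv_monomial, Th_monomial, Th_monomial, Polynomial.coeff_monomial,
      Polynomial.coeff_monomial]
    by_cases hm : m i = 0
    · simp only [hm, Nat.cast_zero, mul_zero, MvPolynomial.monomial_zero, ite_self]
      split_ifs
      · rw [MvPolynomial.pderiv_monomial]; simp [hm]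
      · simp
    · have : wtE w m = wtE w (m - Finsupp.single i 1) + w i := by
        unfold wtE
        fin_cases i
        · simp at hm ⊢
          obtain ⟨k, hk⟩ := Nat.exists_eq_succ_of_ne_zero hm
          rw [hk]; simp; ring
        · simp at hm ⊢
          obtain ⟨k, hk⟩ := Nat.exists_eq_succ_of_ne_zero hm
          rw [hk]; simp; ring
      rw [this]
      by_cases h : wtE w (m - Finsupp.single i 1) = n
      · simp [h, MvPolynomial.pderiv_monomial]
      · simp [h]
  | add p q hp hq => simp [hp, hq]

lemma Th_coeff_coeff (F : MvPolynomial (Fin 2) K) (n : ℕ) (m : Fin 2 →₀ ℕ) :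
    ((Th w F).coeff n).coeff m = if wtE w m = n then F.coeff m else 0 := by
  induction F using MvPolynomial.induction_on' with
  | monomial m' a =>
    rw [Th_monomial, Polynomial.coeff_monomial]
    by_cases h : m' = m
    · subst h; split_ifs <;> simp
    · split_ifs <;> simp [MvPolynomial.coeff_monomial, h]
  | add p q hp hq => simp only [map_add, Polynomial.coeff_add, MvPolynomial.coeff_add, hp, hq]; split_ifs <;> simp

lemma Th_Th (F : MvPolynomial (Fin 2) K) (n : ℕ) :
    Th w ((Th w F).coeff n) = Polynomial.monomial n ((Th w F).coeff n) := by
  induction F using MvPolynomial.induction_on' with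
  | monomial m' a =>
    rw [Th_monomial, Polynomial.coeff_monomial]
    split_ifs with h
    · rw [Th_monomial, h]
    · simp
  | add p q hp hq => simp [hp, hq]

lemma Th_inj : Function.Injective (Th (K := K) w) := by
  intro f g h
  ext m
  have := Th_coeff_coeff w f (wtE w m) m
  rw [h, Th_coeff_coeff] at this
  simpa using this.symm

lemma Th_ne {f : MvPolynomial (Fin 2) K} (h : f ≠ 0) : Th w f ≠ 0 := by
  intro h'; exact h (Th_inj w (by rw [h', map_zero]))

lemma ld_ne {f : MvPolynomial (Fin 2) K} (h : f ≠ 0) : ld w f ≠ 0 :=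
  Polynomial.leadingCoeff_ne_zero.2 (Th_ne w h)

lemma Dw_mul {f g : MvPolynomial (Fin 2) K} (hf : f ≠ 0) (hg : g ≠ 0) :
    Dw w (f * g) = Dw w f + Dw w g := by
  unfold Dw; rw [map_mul, Polynomial.natDegree_mul (Th_ne w hf) (Th_ne w hg)]

lemma Dw_ld (f : MvPolynomial (Fin 2) K) (h : f ≠ 0) : Dw w (ld w f) = Dw w f := by
  classical
  have h1 := ld_ne w h
  unfold Dw ld Polynomial.leadingCoeff at *
  rw [Th_Th, Polynomial.natDegree_monomial, if_neg h1]

lemma ld_ld (f : MvPolynomial (Fin 2) K) : ld w (ld w f) = ld w f := by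
  unfold ld
  conv_lhs => enter [1]; unfold Polynomial.leadingCoeff; rw [Th_Th]
  rw [Polynomial.leadingCoeff_monomial]; rfl

lemma wtE_le {f : MvPolynomial (Fin 2) K} {m : Fin 2 →₀ ℕ} (h : f.coeff m ≠ 0) :
    wtE w m ≤ Dw w f := by
  apply Polynomial.le_natDegree_of_ne_zero
  intro h'
  have := Th_coeff_coeff w f (wtE w m) m
  rw [h'] at this
  simp at this
  exact h this.symm

lemma Dw_pderiv (i : Fin 2) {f : MvPolynomial (Fin 2) K} (h : MvPolynomial.pderiv i f ≠ 0) :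
    Dw w (MvPolynomial.pderiv i f) + w i ≤ Dw w f := by
  apply Polynomial.le_natDegree_of_ne_zero
  intro h'
  have := Th_coeff_pderiv w i f (Dw w (MvPolynomial.pderiv i f))
  rw [h', map_zero] at this
  exact ld_ne w h this

lemma Dw_one (f : MvPolynomial (Fin 2) K) : Dw (fun _ => 1) f = f.totalDegree := by
  apply le_antisymm
  · apply Polynomial.natDegree_le_iff_coeff_eq_zero.2
    intro N hN
    ext m
    rw [Th_coeff_coeff]
    split_ifs with h
    · rw [MvPolynomial.coeff_zero]
      apply MvPolynomial.coeff_eq_zero_of_totalDegree_lt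
      rw [← Finsupp.degree_apply] at *
      simp [Finsupp.degree_eq_sum, wtE] at *
      omega
    · simp
  · apply Finset.sup_le
    intro m hm
    have := wtE_le (fun _ => 1) (MvPolynomial.mem_support_iff.1 hm)
    refine le_trans (le_of_eq ?_) this
    rw [Finsupp.sum_fintype _ _ (by simp)]
    simp [wtE]

lemma Dw_aeval {f : MvPolynomial (Fin 2) K} (hf : 1 ≤ Dw w f) (p : Polynomial K) :
    Dw w (Polynomial.aeval f p) = p.natDegree * Dw w f ∧
    ld w (Polynomial.aeval f p) = MvPolynomial.C p.leadingCoeff * (ld w f) ^ p.natDegree := by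
  have h : Th w (Polynomial.aeval f p) =
      (p.map (algebraMap K (MvPolynomial (Fin 2) K))).comp (Th w f) := by
    rw [← Polynomial.aeval_algHom_apply, Polynomial.comp, Polynomial.eval₂_map,
      Polynomial.aeval_def]
    rfl
  unfold Dw ld
  rw [h, Polynomial.natDegree_comp, Polynomial.leadingCoeff_comp (by unfold Dw at hf; omega)]
  rw [Polynomial.natDegree_map_eq_of_injective (algebraMap K _).injective,
    Polynomial.leadingCoeff_map_of_injective (algebraMap K _).injective]
  exact ⟨rfl, rfl⟩

end

section
variable {K : Type*} [Field K] (w : Fin 2 → ℕ)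

/-- The Jacobian derivation `q ↦ J(f,q)`. -/
noncomputable def Jd (f : MvPolynomial (Fin 2) K) :
    Derivation K (MvPolynomial (Fin 2) K) (MvPolynomial (Fin 2) K) :=
  MvPolynomial.pderiv 0 f • MvPolynomial.pderiv 1 - MvPolynomial.pderiv 1 f • MvPolynomial.pderiv 0

lemma Jd_apply (f q : MvPolynomial (Fin 2) K) : Jd f q =
    MvPolynomial.pderiv 0 f * MvPolynomial.pderiv 1 q -
    MvPolynomial.pderiv 1 f * MvPolynomial.pderiv 0 q := by
  simp [Jd]

lemma Jd_self (f : MvPolynomial (Fin 2) K) : Jd f f = 0 := by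
  rw [Jd_apply]; ring

lemma Jd_swap (f g : MvPolynomial (Fin 2) K) : Jd f g = - Jd g f := by
  rw [Jd_apply, Jd_apply]; ring

lemma Dw_term (i j : Fin 2) (f q : MvPolynomial (Fin 2) K) :
    MvPolynomial.pderiv i f * MvPolynomial.pderiv j q = 0 ∨
    Dw w (MvPolynomial.pderiv i f * MvPolynomial.pderiv j q) + (w i + w j) ≤ Dw w f + Dw w q := by
  by_cases h : MvPolynomial.pderiv i f * MvPolynomial.pderiv j q = 0
  · exact Or.inl h
  · right
    have h1 := left_ne_zero_of_mul h
    have h2 := right_ne_zero_of_mul h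
    rw [Dw_mul w h1 h2]
    have := Dw_pderiv w i h1
    have := Dw_pderiv w j h2
    omega

lemma Dw_sub_le (a b : MvPolynomial (Fin 2) K) : Dw w (a - b) ≤ max (Dw w a) (Dw w b) := by
  unfold Dw; rw [map_sub]; exact Polynomial.natDegree_sub_le _ _

lemma Dw_add_le (a b : MvPolynomial (Fin 2) K) : Dw w (a + b) ≤ max (Dw w a) (Dw w b) := by
  unfold Dw; rw [map_add]; exact Polynomial.natDegree_add_le _ _

lemma Dw_neg (a : MvPolynomial (Fin 2) K) : Dw w (-a) = Dw w a := by
  unfold Dw; rw [map_neg]; exact Polynomial.natDegree_neg _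

lemma Dw_Jd {f q : MvPolynomial (Fin 2) K} (h : Jd f q ≠ 0) :
    Dw w (Jd f q) + (w 0 + w 1) ≤ Dw w f + Dw w q := by
  rw [Jd_apply] at *
  rcases Dw_term w 0 1 f q with h1 | h1 <;> rcases Dw_term w 1 0 f q with h2 | h2
  · simp [h1, h2] at h
  · rw [h1, zero_sub, Dw_neg]; omega
  · rw [h2, sub_zero]; omega
  · have := Dw_sub_le w (MvPolynomial.pderiv 0 f * MvPolynomial.pderiv 1 q)
      (MvPolynomial.pderiv 1 f * MvPolynomial.pderiv 0 q)
    omega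

lemma Dw_pos_of_Jd (hw : ∀ i, 1 ≤ w i) {f q : MvPolynomial (Fin 2) K} (h : Jd f q ≠ 0) :
    1 ≤ Dw w f := by
  by_contra hc
  apply h
  have : ∀ i, MvPolynomial.pderiv i f = 0 := by
    intro i
    by_contra h'
    have := Dw_pderiv w i h'
    have := hw i
    omega
  rw [Jd_apply, this, this]; simp

/-- Evaluation of polynomial in two variables. -/
noncomputable def ev (f g : MvPolynomial (Fin 2) K) :
    Polynomial (Polynomial K) →+* MvPolynomial (Fin 2) K :=
  Polynomial.eval₂RingHom (Polynomial.aeval f : Polynomial K →ₐ[K] _).toRingHom g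

lemma ev_apply (f g : MvPolynomial (Fin 2) K) (P : Polynomial (Polynomial K)) :
    ev f g P = ∑ j ∈ P.support, Polynomial.aeval f (P.coeff j) * g ^ j := by
  simp [ev, Polynomial.eval₂_eq_sum, Polynomial.sum_def]

lemma ev_monomial (f g : MvPolynomial (Fin 2) K) (j : ℕ) (p : Polynomial K) :
    ev f g (Polynomial.monomial j p) = Polynomial.aeval f p * g ^ j := by
  simp [ev]

lemma Jd_ev (f g : MvPolynomial (Fin 2) K) (P : Polynomial (Polynomial K)) :
    Jd f (ev f g P) = ev f g (Polynomial.derivative P) * Jd f g := by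
  induction P using Polynomial.induction_on' with
  | add p q hp hq => simp only [map_add, hp, hq]; ring
  | monomial j p =>
    rw [Polynomial.derivative_monomial, ev_monomial, ev_monomial, Derivation.leibniz,
      Derivation.map_aeval, Jd_self, Derivation.leibniz_pow]
    simp
    ring

lemma ev_surj (f g : MvPolynomial (Fin 2) K) (P : MvPolynomial (Fin 2) K) :
    ∃ Q, ev f g Q = MvPolynomial.aeval ![f, g] P := by
  induction P using MvPolynomial.induction_on with
  | C a => exact ⟨Polynomial.C (Polynomial.C a), by simp [ev]⟩
  | add p q hp hq =>
    obtain ⟨a, ha⟩ := hp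
    obtain ⟨b, hb⟩ := hq
    exact ⟨a + b, by simp [ha, hb]⟩
  | mul_X p i hp =>
    obtain ⟨a, ha⟩ := hp
    fin_cases i
    · exact ⟨a * Polynomial.C Polynomial.X, by simp [ha]; left; simp [ev]⟩
    · exact ⟨a * Polynomial.X, by simp [ha]; left; simp [ev]⟩

lemma exists_two_mul_le {L E : Type*} [Field L] [Field E] [Algebra L E] [CharZero L]
    (θ : E) (hθ : θ ∉ (algebraMap L E).range) (d : ℕ) : ∀ (R : Polynomial L), R ≠ 0 →
    R.natDegree = d →
    2 * (R.map (algebraMap L E)).rootMultiplicity θ ≤ d := by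
  induction d using Nat.strong_induction_on with
  | _ d ih =>
  intro R hR hd
  by_cases h0 : Polynomial.aeval θ R = 0
  · have hint : IsIntegral L θ := isAlgebraic_iff_isIntegral.1 ⟨R, hR, h0⟩
    obtain ⟨S, hS⟩ := minpoly.dvd L θ h0
    have h2 := (minpoly.two_le_natDegree_iff hint).2 hθ
    have hS0 : S ≠ 0 := by rintro rfl; simp at hS; exact hR hS
    have hm0 := minpoly.ne_zero hint
    have hdeg : d = (minpoly L θ).natDegree + S.natDegree := by
      rw [← hd, hS, Polynomial.natDegree_mul hm0 hS0]
    have := ih S.natDegree (by omega) S hS0 rfl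
    have hsep : (minpoly L θ).Separable := (minpoly.irreducible hint).separable
    have h1 := Polynomial.rootMultiplicity_le_one_of_separable
      (hsep.map (f := algebraMap L E)) θ
    have hne : (minpoly L θ).map (algebraMap L E) * S.map (algebraMap L E) ≠ 0 := by
      rw [← Polynomial.map_mul, ← hS]
      exact (Polynomial.map_ne_zero_iff (algebraMap L E).injective).2 hR
    have h3 := Polynomial.rootMultiplicity_mul (x := θ) hne
    rw [← Polynomial.map_mul, ← hS] at h3
    omega
  · have : Polynomial.rootMultiplicity θ (R.map (algebraMap L E)) = 0 := by
      apply Polynomial.rootMultiplicity_eq_zero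
      rw [Polynomial.IsRoot.def, Polynomial.eval_map_algebraMap]
      exact h0
    omega

lemma exists_deriv_ne {L E : Type*} [Field L] [Field E] [Algebra L E] [CharZero L]
    (θ : E) (hθ : θ ∉ (algebraMap L E).range) (R : Polynomial L) (hR : R ≠ 0) :
    ∃ k, 2 * k ≤ R.natDegree ∧ Polynomial.aeval θ (Polynomial.derivative^[k] R) ≠ 0 := by
  have : CharZero E := charZero_of_injective_algebraMap (algebraMap L E).injective
  refine ⟨_, exists_two_mul_le θ hθ _ R hR rfl, ?_⟩
  have hR' : R.map (algebraMap L E) ≠ 0 :=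
    (Polynomial.map_ne_zero_iff (algebraMap L E).injective).2 hR
  rw [← Polynomial.eval_map_algebraMap, ← Polynomial.iterate_derivative_map,
    Polynomial.eval_iterate_derivative_rootMultiplicity, nsmul_eq_mul]
  exact mul_ne_zero (Nat.cast_ne_zero.2 (Nat.factorial_ne_zero _))
    (Polynomial.eval_divByMonic_pow_rootMultiplicity_ne_zero θ hR')

end

section
variable {K : Type*} [Field K] (w : Fin 2 → ℕ)

open Classical in
/-- leading part of a polynomial with respect to the weights `n`, `m` -/
noncomputable def tl {L : Type*} [Field L] [Algebra K L] (φ : L) (n m W k : ℕ)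
    (Q : Polynomial (Polynomial K)) : Polynomial L :=
  ∑ j ∈ Q.support, Polynomial.monomial j
    (if n * (Q.coeff j).natDegree + (j + k) * m = W then
      algebraMap K L (Q.coeff j).leadingCoeff * φ ^ (Q.coeff j).natDegree else 0)

lemma tl_coeff {L : Type*} [Field L] [Algebra K L] (φ : L) (n m W k : ℕ)
    (Q : Polynomial (Polynomial K)) (j : ℕ) :
    (tl φ n m W k Q).coeff j = 
    (if n * (Q.coeff j).natDegree + (j + k) * m = W then
      algebraMap K L (Q.coeff j).leadingCoeff * φ ^ (Q.coeff j).natDegree else 0) := by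
  rw [tl, Polynomial.finsetSum_coeff]
  simp only [Polynomial.coeff_monomial]
  rw [Finset.sum_ite_eq' Q.support j]
  by_cases h : j ∈ Q.support
  · rw [if_pos h]
  · rw [if_neg h]
    rw [Polynomial.notMem_support_iff] at h
    simp [h]

lemma coeff_der (Q : Polynomial (Polynomial K)) (j : ℕ) :
    (Polynomial.derivative Q).coeff j = Polynomial.C ((j : K) + 1) * Q.coeff (j + 1) := by
  rw [Polynomial.coeff_derivative, mul_comm]
  simp

lemma tl_der [CharZero K] {L : Type*} [Field L] [Algebra K L] (φ : L) (n m W k : ℕ)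
    (Q : Polynomial (Polynomial K)) :
    Polynomial.derivative (tl φ n m W k Q) = tl φ n m W (k + 1) (Polynomial.derivative Q) := by
  ext j
  have hj : (j : K) + 1 ≠ 0 := by exact_mod_cast Nat.succ_ne_zero j
  rw [Polynomial.coeff_derivative, tl_coeff, tl_coeff, coeff_der,
    Polynomial.natDegree_C_mul hj, Polynomial.leadingCoeff_mul, Polynomial.leadingCoeff_C,
    show j + 1 + k = j + (k + 1) by ring]
  split_ifs
  · simp; ring
  · simp

lemma tl_iter [CharZero K] {L : Type*} [Field L] [Algebra K L] (φ : L) (n m W k : ℕ)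
    (Q : Polynomial (Polynomial K)) :
    Polynomial.derivative^[k] (tl φ n m W 0 Q) = tl φ n m W k (Polynomial.derivative^[k] Q) := by
  induction k with
  | zero => rfl
  | succ k ih => rw [Function.iterate_succ_apply', Function.iterate_succ_apply', ih, tl_der]

lemma bd_iter [CharZero K] (n m W k : ℕ) (Q : Polynomial (Polynomial K))
    (h : ∀ j, Q.coeff j ≠ 0 → n * (Q.coeff j).natDegree + (j + 0) * m ≤ W) :
    ∀ j, (Polynomial.derivative^[k] Q).coeff j ≠ 0 →
      n * ((Polynomial.derivative^[k] Q).coeff j).natDegree + (j + k) * m ≤ W := by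
  induction k with
  | zero => exact h
  | succ k ih =>
    intro j hj
    have hj' : (j : K) + 1 ≠ 0 := by exact_mod_cast Nat.succ_ne_zero j
    rw [Function.iterate_succ_apply', coeff_der] at *
    rw [Polynomial.natDegree_C_mul hj']
    have := ih (j + 1) (right_ne_zero_of_mul hj)
    rw [show j + 1 + k = j + (k + 1) by ring] at this
    exact this

lemma coeff_top {p : Polynomial (MvPolynomial (Fin 2) K)} {N : ℕ} (h : p.natDegree ≤ N) :
    p.coeff N = if p.natDegree = N then p.leadingCoeff else 0 := by
  split_ifs with h'
  · rw [← h']; rfl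
  · exact Polynomial.coeff_eq_zero_of_natDegree_lt (lt_of_le_of_ne h h')

lemma Dw_pow (g : MvPolynomial (Fin 2) K) (k : ℕ) : Dw w (g ^ k) = k * Dw w g := by
  unfold Dw; rw [map_pow, Polynomial.natDegree_pow]

lemma ld_pow (g : MvPolynomial (Fin 2) K) (k : ℕ) : ld w (g ^ k) = ld w g ^ k := by
  unfold ld; rw [map_pow, Polynomial.leadingCoeff_pow]

lemma ld_mul (f g : MvPolynomial (Fin 2) K) : ld w (f * g) = ld w f * ld w g := by
  unfold ld; rw [map_mul, Polynomial.leadingCoeff_mul]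

lemma tl_le {L : Type*} [Field L] [Algebra K L] [Algebra L (FractionRing (MvPolynomial (Fin 2) K))]
    [IsScalarTower K L (FractionRing (MvPolynomial (Fin 2) K))] (φ : L)
    (f g : MvPolynomial (Fin 2) K) (hf : 1 ≤ Dw w f) (hg : g ≠ 0)
    (hφ : algebraMap L (FractionRing (MvPolynomial (Fin 2) K)) φ = algebraMap _ _ (ld w f))
    (W k : ℕ)
    (Q : Polynomial (Polynomial K))
    (h : ∀ j, Q.coeff j ≠ 0 → (Dw w f) * (Q.coeff j).natDegree + (j + k) * (Dw w g) ≤ W)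
    (hne : Polynomial.aeval (algebraMap _ (FractionRing (MvPolynomial (Fin 2) K)) (ld w g))
      (tl φ (Dw w f) (Dw w g) W k Q) ≠ 0) :
    ev f g Q ≠ 0 ∧ W ≤ Dw w (ev f g Q) + k * Dw w g := by
  have key : algebraMap _ (FractionRing (MvPolynomial (Fin 2) K))
      ((Th w (ev f g Q * g ^ k)).coeff W) =
      Polynomial.aeval (algebraMap _ (FractionRing (MvPolynomial (Fin 2) K)) (ld w g))
      (tl φ (Dw w f) (Dw w g) W k Q) * 
      (algebraMap _ (FractionRing (MvPolynomial (Fin 2) K)) (ld w g)) ^ k := by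
    rw [ev_apply, Finset.sum_mul, map_sum, Polynomial.finsetSum_coeff, map_sum, tl, map_sum,
      Finset.sum_mul]
    apply Finset.sum_congr rfl
    intro j hj
    have hq : Q.coeff j ≠ 0 := Polynomial.mem_support_iff.1 hj
    have hb := h j hq
    obtain ⟨h1, h2⟩ := Dw_aeval w hf (Q.coeff j)
    have hne0 : Polynomial.aeval f (Q.coeff j) ≠ 0 := by
      intro h0
      rw [h0] at h2
      have : f ≠ 0 := by rintro rfl; simp [Dw] at hf
      have h3 := pow_ne_zero (Q.coeff j).natDegree (ld_ne w this)
      have h4 : (MvPolynomial.C (Q.coeff j).leadingCoeff : MvPolynomial (Fin 2) K) ≠ 0 := by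
        simpa using hq
      apply mul_ne_zero h4 h3
      rw [← h2]; simp [ld]
    have hD : Dw w (Polynomial.aeval f (Q.coeff j) * g ^ j * g ^ k) =
        (Dw w f) * (Q.coeff j).natDegree + (j + k) * (Dw w g) := by
      rw [mul_assoc, ← pow_add, Dw_mul w hne0 (pow_ne_zero _ hg), Dw_pow, h1]; ring
    have hl : ld w (Polynomial.aeval f (Q.coeff j) * g ^ j * g ^ k) =
        MvPolynomial.C (Q.coeff j).leadingCoeff * (ld w f) ^ (Q.coeff j).natDegree
         * ld w g ^ j * ld w g ^ k := by
      rw [ld_mul, ld_mul, ld_pow, ld_pow, h2]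
    rw [coeff_top (hD.trans_le hb)]
    change algebraMap _ _ (if Dw w _ = W then ld w _ else 0) = _
    rw [hD, hl, Polynomial.aeval_monomial]
    split_ifs
    · simp only [map_mul, map_pow, hφ, ← IsScalarTower.algebraMap_apply K L]
      rw [IsScalarTower.algebraMap_apply K (MvPolynomial (Fin 2) K)
        (FractionRing (MvPolynomial (Fin 2) K)), MvPolynomial.algebraMap_eq]
    · simp
  have hg' : algebraMap _ (FractionRing (MvPolynomial (Fin 2) K)) (ld w g) ≠ 0 := by
    rw [Ne, FaithfulSMul.algebraMap_eq_zero_iff]; exact ld_ne w hg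
  have hc : (Th w (ev f g Q * g ^ k)).coeff W ≠ 0 := by
    intro h0
    rw [h0, map_zero] at key
    exact mul_ne_zero hne (pow_ne_zero k hg') key.symm
  have hev : ev f g Q ≠ 0 := by
    intro h0; rw [h0] at hc; simp at hc
  refine ⟨hev, ?_⟩
  have := Polynomial.le_natDegree_of_ne_zero hc
  change W ≤ Dw w _ at this
  rwa [Dw_mul w hev (pow_ne_zero _ hg), Dw_pow] at this

lemma der_step {f g : MvPolynomial (Fin 2) K} (hJ : Jd f g ≠ 0) (Q : Polynomial (Polynomial K))
    (h : ev f g (Polynomial.derivative Q) ≠ 0) :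
    Dw w (ev f g (Polynomial.derivative Q)) + (w 0 + w 1) ≤ Dw w f + Dw w (ev f g Q) := by
  have h1 := Jd_ev f g Q
  have h2 := Dw_Jd w (f := f) (q := ev f g Q) (by rw [h1]; exact mul_ne_zero h hJ)
  rw [h1, Dw_mul w h hJ] at h2
  omega

lemma der_iter {f g : MvPolynomial (Fin 2) K} (hJ : Jd f g ≠ 0) (Q : Polynomial (Polynomial K))
    (k : ℕ) (h : ev f g (Polynomial.derivative^[k] Q) ≠ 0) :
    Dw w (ev f g (Polynomial.derivative^[k] Q)) + k * (w 0 + w 1) ≤ k * Dw w f + Dw w (ev f g Q) := by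
  induction k with
  | zero => simp
  | succ k ih =>
    rw [Function.iterate_succ_apply'] at *
    have h1 := der_step w hJ _ h
    have : ev f g (Polynomial.derivative^[k] Q) ≠ 0 := by
      intro h0
      have h3 := Jd_ev f g (Polynomial.derivative^[k] Q)
      rw [h0, map_zero] at h3
      exact mul_ne_zero h hJ h3.symm
    have h2 := ih this
    nlinarith

lemma key_lemma [CharZero K] {f g : MvPolynomial (Fin 2) K} (hf : 1 ≤ Dw w f)
    (hfg : Dw w f ≤ Dw w g)
    (hJ : Jd f g ≠ 0)
    (hl : algebraMap _ (FractionRing (MvPolynomial (Fin 2) K)) (ld w g) ∉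
      IntermediateField.adjoin K {algebraMap _ (FractionRing (MvPolynomial (Fin 2) K)) (ld w f)})
    (P : Polynomial (Polynomial K)) (hP : P ≠ 0) (hd : Dw w (ev f g P) < w 0 + w 1) :
    ∀ j, P.coeff j ≠ 0 → Dw w f * (P.coeff j).natDegree + j * Dw w g ≤ Dw w (ev f g P) := by
  have hf0 : f ≠ 0 := by rintro rfl; simp [Dw] at hf
  have hg0 : g ≠ 0 := by rintro rfl; simp at hJ
  set E := FractionRing (MvPolynomial (Fin 2) K)
  set α : E := algebraMap _ E (ld w f) with hα
  set θ : E := algebraMap _ E (ld w g) with hθ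
  let φ : IntermediateField.adjoin K {α} := IntermediateField.AdjoinSimple.gen K α
  have hφ : algebraMap (IntermediateField.adjoin K {α}) E φ = algebraMap _ E (ld w f) := rfl
  have hα0 : α ≠ 0 := by
    rw [Ne, FaithfulSMul.algebraMap_eq_zero_iff]; exact ld_ne w hf0
  have hφ0 : φ ≠ 0 := by
    intro h0; rw [h0, map_zero] at hφ; exact hα0 hφ.symm
  obtain ⟨W, hW⟩ : ∃ W, W = P.support.sup
      (fun j => Dw w f * (P.coeff j).natDegree + j * Dw w g) := ⟨_, rfl⟩
  have hb : ∀ j, P.coeff j ≠ 0 → Dw w f * (P.coeff j).natDegree + (j + 0) * Dw w g ≤ W := by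
    intro j hj
    rw [hW]
    exact Finset.le_sup (f := fun j => Dw w f * (P.coeff j).natDegree + j * Dw w g)
      (Polynomial.mem_support_iff.2 hj)
  have ht : tl φ (Dw w f) (Dw w g) W 0 P ≠ 0 := by
    obtain ⟨j, hj, hj'⟩ := Finset.exists_mem_eq_sup P.support (Polynomial.nonempty_support_iff.2 hP)
      (fun j => Dw w f * (P.coeff j).natDegree + j * Dw w g)
    intro h0
    have h1 := tl_coeff φ (Dw w f) (Dw w g) W 0 P j
    rw [h0, if_pos (by rw [hW, hj']; simp)] at h1
    simp at h1
    rcases h1 with h1 | h1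
    · exact Polynomial.mem_support_iff.1 hj h1
    · exact hφ0 h1.1
  obtain ⟨k, hk, hk'⟩ := exists_deriv_ne θ (L := IntermediateField.adjoin K {α})
    (by rintro ⟨x, hx⟩; apply hl; rw [← hx]; exact x.2) _ ht
  rw [tl_iter] at hk'
  obtain ⟨h1, h2⟩ := tl_le w φ f g hf hg0 hφ W k _ (bd_iter _ _ W k P hb) hk'
  have h3 := der_iter w hJ P k h1
  have h4 : (tl φ (Dw w f) (Dw w g) W 0 P).natDegree * Dw w g ≤ W := by
    have h5 : (tl φ (Dw w f) (Dw w g) W 0 P).coeff (tl φ (Dw w f) (Dw w g) W 0 P).natDegree ≠ 0 :=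
      Polynomial.leadingCoeff_ne_zero.2 ht
    rw [tl_coeff] at h5
    have h6 := (ite_ne_right_iff.1 h5).1
    simp only [add_zero] at h6
    omega
  have h5 : 2 * k * Dw w g ≤ W := le_trans (Nat.mul_le_mul_right _ hk) h4
  have h6 : k * Dw w f ≤ k * Dw w g := Nat.mul_le_mul_left _ hfg
  have hk0 : k = 0 := by
    by_contra hk0
    have : w 0 + w 1 ≤ k * (w 0 + w 1) := Nat.le_mul_of_pos_left _ (Nat.pos_of_ne_zero hk0)
    nlinarith
  subst hk0
  simp at h2
  intro j hj
  have := hb j hj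
  simp at this
  omega

lemma ld_of_mem {f g : MvPolynomial (Fin 2) K} (hf : 1 ≤ Dw w f) (hg : 1 ≤ Dw w g)
    (hl : algebraMap _ (FractionRing (MvPolynomial (Fin 2) K)) (ld w g) ∈
      IntermediateField.adjoin K {algebraMap _ (FractionRing (MvPolynomial (Fin 2) K)) (ld w f)}) :
    ∃ (c : K) (s : ℕ), Dw w (g - MvPolynomial.C c * f ^ s) < Dw w g := by
  have hf0 : f ≠ 0 := by rintro rfl; simp [Dw] at hf
  have hg0 : g ≠ 0 := by rintro rfl; simp [Dw] at hg
  obtain ⟨r, s, hrs⟩ := (IntermediateField.mem_adjoin_simple_iff K _).1 hl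
  have hθ0 : algebraMap _ (FractionRing (MvPolynomial (Fin 2) K)) (ld w g) ≠ 0 := by
    rw [Ne, FaithfulSMul.algebraMap_eq_zero_iff]; exact ld_ne w hg0
  rw [Polynomial.aeval_algebraMap_apply, Polynomial.aeval_algebraMap_apply] at hrs
  have hs0 : algebraMap _ (FractionRing (MvPolynomial (Fin 2) K)) (Polynomial.aeval (ld w f) s) ≠ 0 := by
    intro h0; rw [h0, div_zero] at hrs; exact hθ0 hrs
  rw [eq_div_iff hs0, ← map_mul] at hrs
  have h1 := FaithfulSMul.algebraMap_injective _ _ hrs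
  have hs1 : Polynomial.aeval (ld w f) s ≠ 0 := by
    intro h0; rw [h0] at hs0; simp at hs0
  have hD := congrArg (Dw w) h1
  have hL := congrArg (ld w) h1
  have hf' : 1 ≤ Dw w (ld w f) := by rwa [Dw_ld w f hf0]
  rw [Dw_mul w (ld_ne w hg0) hs1, (Dw_aeval w hf' r).1, (Dw_aeval w hf' s).1, Dw_ld w f hf0,
    Dw_ld w g hg0] at hD
  rw [ld_mul, (Dw_aeval w hf' r).2, (Dw_aeval w hf' s).2, ld_ld, ld_ld] at hL
  have hsl : s.leadingCoeff ≠ 0 := by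
    rw [Polynomial.leadingCoeff_ne_zero]; rintro rfl; simp at hs1
  have hle : s.natDegree ≤ r.natDegree := by
    by_contra hc
    have : r.natDegree * Dw w f ≤ s.natDegree * Dw w f := Nat.mul_le_mul_right _ (by omega)
    omega
  obtain ⟨e, he⟩ := Nat.exists_eq_add_of_le hle
  have hDe : Dw w g = e * Dw w f := by rw [he] at hD; linarith
  have hLe : ld w g = MvPolynomial.C (r.leadingCoeff / s.leadingCoeff) * ld w f ^ e := by
    have : (ld w f ^ s.natDegree) * MvPolynomial.C s.leadingCoeff ≠ 0 :=
      mul_ne_zero (pow_ne_zero _ (ld_ne w hf0)) (by simpa using hsl)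
    apply mul_left_cancel₀ this
    have h3 : (MvPolynomial.C r.leadingCoeff : MvPolynomial (Fin 2) K) =
      MvPolynomial.C s.leadingCoeff * MvPolynomial.C (r.leadingCoeff / s.leadingCoeff) := by
      rw [← MvPolynomial.C_mul, mul_div_cancel₀ _ hsl]
    rw [he, h3] at hL
    linear_combination hL
  set c := r.leadingCoeff / s.leadingCoeff
  have hc : c ≠ 0 := by
    intro h0; rw [h0] at hLe; simp at hLe; exact ld_ne w hg0 hLe
  refine ⟨c, e, ?_⟩
  have hCc : (MvPolynomial.C c : MvPolynomial (Fin 2) K) ≠ 0 := by simpa using hc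
  have hThC : Th w (MvPolynomial.C c : MvPolynomial (Fin 2) K) = Polynomial.C (MvPolynomial.C c) := by
    rw [Th, MvPolynomial.aeval_C]; rfl
  have h4 : Dw w (MvPolynomial.C c * f ^ e) = Dw w g := by
    rw [Dw_mul w hCc (pow_ne_zero _ hf0), Dw_pow, hDe]
    have : Dw w (MvPolynomial.C c : MvPolynomial (Fin 2) K) = 0 := by
      rw [Dw, hThC, Polynomial.natDegree_C]
    omega
  have h5 : ld w (MvPolynomial.C c * f ^ e) = ld w g := by
    rw [ld_mul, ld_pow, hLe]
    congr 1
    rw [ld, hThC, Polynomial.leadingCoeff_C]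
  have h6 : Th w (MvPolynomial.C c * f ^ e) ≠ 0 := Th_ne w (mul_ne_zero hCc (pow_ne_zero _ hf0))
  have h7 : Polynomial.degree (Th w g - Th w (MvPolynomial.C c * f ^ e)) < (Th w g).degree := by
    apply Polynomial.degree_sub_lt_left _ (Th_ne w hg0) h5.symm
    rw [Polynomial.degree_eq_natDegree h6, Polynomial.degree_eq_natDegree (Th_ne w hg0)]
    exact congrArg _ h4.symm
  rw [← map_sub] at h7
  by_cases h8 : g - MvPolynomial.C c * f ^ e = 0
  · rw [h8]; simp only [Dw, map_zero, Polynomial.natDegree_zero]; exact hg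
  · exact Polynomial.natDegree_lt_natDegree (Th_ne w h8) h7

end

section
variable {K : Type*} [Field K] (w : Fin 2 → ℕ)

/-- `F`, `G` generate the polynomial ring. -/
def Gen (F G : MvPolynomial (Fin 2) K) : Prop :=
  Function.Surjective (MvPolynomial.aeval ![F, G] :
    MvPolynomial (Fin 2) K →ₐ[K] MvPolynomial (Fin 2) K)

lemma Gen.swap {F G : MvPolynomial (Fin 2) K} (h : Gen F G) : Gen G F := by
  have : (MvPolynomial.aeval ![F, G] : MvPolynomial (Fin 2) K →ₐ[K] MvPolynomial (Fin 2) K) =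
    (MvPolynomial.aeval ![G, F]).comp
      (MvPolynomial.aeval ![MvPolynomial.X 1, MvPolynomial.X 0]) := by
    ext i; fin_cases i <;> simp
  rw [Gen, this] at h
  exact Function.Surjective.of_comp h

lemma Gen.sub {F G : MvPolynomial (Fin 2) K} (h : Gen F G) (c : K) (s : ℕ) :
    Gen F (G - MvPolynomial.C c * F ^ s) := by
  have : (MvPolynomial.aeval ![F, G] : MvPolynomial (Fin 2) K →ₐ[K] MvPolynomial (Fin 2) K) =
    (MvPolynomial.aeval ![F, G - MvPolynomial.C c * F ^ s]).comp
      (MvPolynomial.aeval ![MvPolynomial.X 0, MvPolynomial.X 1 +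
        MvPolynomial.C c * MvPolynomial.X 0 ^ s]) := by
    ext i; fin_cases i <;> simp [MvPolynomial.algebraMap_eq]
  rw [Gen, this] at h
  exact Function.Surjective.of_comp h

lemma chain_rule (F G P : MvPolynomial (Fin 2) K) : ∃ A B, ∀ i,
    MvPolynomial.pderiv i (MvPolynomial.aeval ![F, G] P) =
      A * MvPolynomial.pderiv i F + B * MvPolynomial.pderiv i G := by
  induction P using MvPolynomial.induction_on with
  | C a => exact ⟨0, 0, by simp [MvPolynomial.algebraMap_eq]⟩
  | add p q hp hq =>
    obtain ⟨a, b, h⟩ := hp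
    obtain ⟨a', b', h'⟩ := hq
    exact ⟨a + a', b + b', fun i => by rw [map_add, map_add, h, h']; ring⟩
  | mul_X p i hp =>
    obtain ⟨a, b, h⟩ := hp
    fin_cases i
    · exact ⟨a * F + MvPolynomial.aeval ![F, G] p, b * F, fun i => by
        rw [map_mul, Derivation.leibniz, h]; simp; ring⟩
    · exact ⟨a * G, b * G + MvPolynomial.aeval ![F, G] p, fun i => by
        rw [map_mul, Derivation.leibniz, h]; simp; ring⟩

lemma Gen.Jd_ne {F G : MvPolynomial (Fin 2) K} (h : Gen F G) : Jd F G ≠ 0 := by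
  obtain ⟨P, hP⟩ := h (MvPolynomial.X 0)
  obtain ⟨Q, hQ⟩ := h (MvPolynomial.X 1)
  obtain ⟨a, b, h1⟩ := chain_rule F G P
  obtain ⟨a', b', h2⟩ := chain_rule F G Q
  rw [hP] at h1
  rw [hQ] at h2
  intro h0
  rw [Jd_apply] at h0
  have e1 := h1 0
  have e2 := h1 1
  have e3 := h2 0
  have e4 := h2 1
  simp [MvPolynomial.pderiv_X] at e1 e2 e3 e4
  have : (1 : MvPolynomial (Fin 2) K) = 0 := by
    linear_combination (a * b' - a' * b) * h0 + e1 + (a * MvPolynomial.pderiv 0 F + b * MvPolynomial.pderiv 0 G) * e4 - (a * MvPolynomial.pderiv 1 F + b * MvPolynomial.pderiv 1 G) * e3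
  exact one_ne_zero this

lemma Dw_X (i : Fin 2) : Dw w (MvPolynomial.X i : MvPolynomial (Fin 2) K) = w i := by
  rw [Dw, Th, MvPolynomial.aeval_X, Polynomial.natDegree_C_mul_X_pow]
  exact MvPolynomial.X_ne_zero i

lemma Dw_C (c : K) : Dw w (MvPolynomial.C c : MvPolynomial (Fin 2) K) = 0 := by
  rw [Dw, Th, MvPolynomial.aeval_C]
  exact Polynomial.natDegree_C _

lemma Dw_C_mul {c : K} (hc : c ≠ 0) (f : MvPolynomial (Fin 2) K) :
    Dw w (MvPolynomial.C c * f) = Dw w f := by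
  by_cases hf : f = 0
  · simp [hf]
  rw [Dw_mul w (by simpa using hc) hf, Dw_C, zero_add]

lemma jung_aux [CharZero K] (hw : ∀ i, 1 ≤ w i) {F G : MvPolynomial (Fin 2) K} (h : Gen F G)
    (hFG : Dw w F ≤ Dw w G)
    (hl : algebraMap _ (FractionRing (MvPolynomial (Fin 2) K)) (ld w G) ∉
      IntermediateField.adjoin K {algebraMap _ (FractionRing (MvPolynomial (Fin 2) K)) (ld w F)})
    (i : Fin 2) :
    Dw w G ≤ w i ∨ (Dw w F ≤ w i ∧ ∃ p : Polynomial K, MvPolynomial.X i = Polynomial.aeval F p) := by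
  have hJ := h.Jd_ne
  have hF := Dw_pos_of_Jd w hw hJ
  obtain ⟨P', hP'⟩ := h (MvPolynomial.X i)
  obtain ⟨P, hP⟩ := ev_surj F G P'
  rw [hP'] at hP
  have hP0 : P ≠ 0 := by
    rintro rfl
    rw [map_zero] at hP
    exact MvPolynomial.X_ne_zero i hP.symm
  have hwi : w i < w 0 + w 1 := by
    have := hw 0
    have := hw 1
    fin_cases i <;> simp <;> omega
  have key := key_lemma w hF hFG hJ hl P hP0 (by rw [hP, Dw_X]; exact hwi)
  rw [hP, Dw_X] at key
  by_cases hj : ∃ j, 1 ≤ j ∧ P.coeff j ≠ 0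
  · obtain ⟨j, hj1, hj⟩ := hj
    left
    have := key j hj
    have : 1 * Dw w G ≤ j * Dw w G := Nat.mul_le_mul_right _ hj1
    omega
  · right
    push Not at hj
    have hPC : P = Polynomial.C (P.coeff 0) := by
      ext1 j
      rcases Nat.eq_zero_or_pos j with rfl | hj0
      · simp
      · rw [hj j hj0, Polynomial.coeff_C_of_ne_zero (by omega)]
    have hX : MvPolynomial.X i = Polynomial.aeval F (P.coeff 0) := by
      rw [← hP, hPC]; simp [ev]
    refine ⟨?_, _, hX⟩
    have h1 := (Dw_aeval w hF (P.coeff 0)).1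
    rw [← hX, Dw_X] at h1
    exact Nat.le_of_dvd (hw i) ⟨_, by rw [h1, mul_comm]⟩

lemma jung [CharZero K] (hw : ∀ i, 1 ≤ w i) {F G : MvPolynomial (Fin 2) K} (h : Gen F G)
    (hFG : Dw w F ≤ Dw w G) :
    (∃ (c : K) (s : ℕ), Dw w (G - MvPolynomial.C c * F ^ s) < Dw w G) ∨
    (Dw w F ≤ w 0 ∧ Dw w F ≤ w 1 ∧ (Dw w G ≤ w 0 ∨ Dw w G ≤ w 1)) := by
  have hJ := h.Jd_ne
  have hF := Dw_pos_of_Jd w hw hJ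
  by_cases hl : algebraMap _ (FractionRing (MvPolynomial (Fin 2) K)) (ld w G) ∈
      IntermediateField.adjoin K {algebraMap _ (FractionRing (MvPolynomial (Fin 2) K)) (ld w F)}
  · exact Or.inl (ld_of_mem w hF (by omega) hl)
  · right
    rcases jung_aux w hw h hFG hl 0 with h0 | ⟨h0, p, hp⟩ <;>
    rcases jung_aux w hw h hFG hl 1 with h1 | ⟨h1, q, hq⟩
    · omega
    · omega
    · omega
    · exfalso
      have h2 : Jd (MvPolynomial.X 0) (MvPolynomial.X 1 : MvPolynomial (Fin 2) K) = 0 := by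
        rw [hq, Derivation.map_aeval, Jd_swap, hp, Derivation.map_aeval, Jd_self]
        simp
      rw [Jd_apply] at h2
      simp [MvPolynomial.pderiv_X] at h2

lemma shapeF (h0 : 1 ≤ w 0) (h01 : w 0 < w 1) {F : MvPolynomial (Fin 2) K} (h : Dw w F ≤ w 0) :
    ∃ p : Polynomial K, p.natDegree ≤ 1 ∧ F = Polynomial.aeval (MvPolynomial.X 0) p := by
  rw [F.as_sum]
  apply Finset.sum_induction
    (p := fun F : MvPolynomial (Fin 2) K => ∃ p : Polynomial K, p.natDegree ≤ 1 ∧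
      F = Polynomial.aeval (MvPolynomial.X 0) p)
  · rintro _ _ ⟨p, hp, rfl⟩ ⟨q, hq, rfl⟩
    exact ⟨p + q, (Polynomial.natDegree_add_le _ _).trans (max_le hp hq), by simp⟩
  · exact ⟨0, by simp, by simp⟩
  · intro m hm
    have := (wtE_le w (MvPolynomial.mem_support_iff.1 hm)).trans h
    unfold wtE at this
    have h1 : m 1 = 0 := by
      by_contra hc
      have : 1 * w 1 ≤ m 1 * w 1 := Nat.mul_le_mul_right _ (by omega)
      omega
    have h2 : m 0 ≤ 1 := by
      by_contra hc
      have : 2 * w 0 ≤ m 0 * w 0 := Nat.mul_le_mul_right _ (by omega)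
      omega
    refine ⟨Polynomial.monomial (m 0) (F.coeff m), (Polynomial.natDegree_monomial_le _).trans h2, ?_⟩
    rw [Polynomial.aeval_monomial, MvPolynomial.monomial_eq, Finsupp.prod_fintype _ _ (by simp)]
    simp [h1, MvPolynomial.algebraMap_eq]

lemma shapeG (h0 : 1 ≤ w 0) (h01 : w 0 < w 1) {G : MvPolynomial (Fin 2) K} (h : Dw w G ≤ w 1) :
    ∃ (γ : K) (q : Polynomial K), G = MvPolynomial.C γ * MvPolynomial.X 1 +
      Polynomial.aeval (MvPolynomial.X 0) q := by
  rw [G.as_sum]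
  apply Finset.sum_induction
    (p := fun F : MvPolynomial (Fin 2) K => ∃ (γ : K) (q : Polynomial K),
      F = MvPolynomial.C γ * MvPolynomial.X 1 + Polynomial.aeval (MvPolynomial.X 0) q)
  · rintro _ _ ⟨γ, p, rfl⟩ ⟨γ', q, rfl⟩
    exact ⟨γ + γ', p + q, by simp; ring⟩
  · exact ⟨0, 0, by simp⟩
  · intro m hm
    have := (wtE_le w (MvPolynomial.mem_support_iff.1 hm)).trans h
    unfold wtE at this
    have h1 : m 1 ≤ 1 := by
      by_contra hc
      have : 2 * w 1 ≤ m 1 * w 1 := Nat.mul_le_mul_right _ (by omega)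
      omega
    rcases Nat.le_one_iff_eq_zero_or_eq_one.1 h1 with h1 | h1
    · refine ⟨0, Polynomial.monomial (m 0) (G.coeff m), ?_⟩
      rw [Polynomial.aeval_monomial, MvPolynomial.monomial_eq, Finsupp.prod_fintype _ _ (by simp)]
      simp [h1, MvPolynomial.algebraMap_eq]
    · have h2 : m 0 = 0 := by
        by_contra hc
        have h3 : 1 * w 0 ≤ m 0 * w 0 := Nat.mul_le_mul_right _ (by omega)
        rw [h1] at this
        omega
      refine ⟨G.coeff m, 0, ?_⟩
      rw [MvPolynomial.monomial_eq, Finsupp.prod_fintype _ _ (by simp)]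
      simp [h1, h2]

/-- In the minimal case the pair has triangular shape. -/
lemma shape (h0 : 1 ≤ w 0) (h01 : w 0 < w 1) {F G : MvPolynomial (Fin 2) K} (hG : Gen F G)
    (h : Dw w F ≤ w 0) (h' : Dw w G ≤ w 1) :
    ∃ (p q : Polynomial K) (γ : K), p.natDegree = 1 ∧ γ ≠ 0 ∧
      F = Polynomial.aeval (MvPolynomial.X 0) p ∧
      G = MvPolynomial.C γ * MvPolynomial.X 1 + Polynomial.aeval (MvPolynomial.X 0) q ∧
      Dw w G = w 1 := by
  obtain ⟨p, hp, hF⟩ := shapeF w h0 h01 h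
  obtain ⟨γ, q, hq⟩ := shapeG w h0 h01 h'
  have hJ := hG.Jd_ne
  have e1 : MvPolynomial.pderiv 1 F = 0 := by
    rw [hF, Derivation.map_aeval]; simp [MvPolynomial.pderiv_X]
  have e2 : MvPolynomial.pderiv 1 G = MvPolynomial.C γ := by
    rw [hq, map_add, Derivation.map_aeval]; simp [MvPolynomial.pderiv_X]
  rw [Jd_apply, e1, e2, zero_mul, sub_zero] at hJ
  have hγ : γ ≠ 0 := by rintro rfl; simp at hJ
  refine ⟨p, q, γ, ?_, hγ, hF, hq, ?_⟩
  · by_contra hc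
    have : p.natDegree = 0 := by omega
    rw [Polynomial.eq_C_of_natDegree_eq_zero this] at hF
    rw [hF] at hJ
    simp [MvPolynomial.algebraMap_eq] at hJ
  · have := Dw_pderiv w 1 (f := G) (by rw [e2]; simpa using hγ)
    omega

end

section
variable {K : Type*} [Field K]

/-- the constant weight -/
def w1 : Fin 2 → ℕ := fun _ => 1

/-- the substitution `X ↦ u, Y ↦ u v` -/
noncomputable def sg (u v : MvPolynomial (Fin 2) K) :
    MvPolynomial (Fin 2) K →ₐ[K] MvPolynomial (Fin 2) K := MvPolynomial.aeval ![u, u * v]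

lemma sg_aeval (u v : MvPolynomial (Fin 2) K) (q : Polynomial K) :
    sg u v (Polynomial.aeval (MvPolynomial.X 0) q) = Polynomial.aeval u q := by
  rw [← Polynomial.aeval_algHom_apply]; simp [sg]

lemma base_case {u v : MvPolynomial (Fin 2) K} {w : Fin 2 → ℕ}
    (hu : 1 ≤ Dw w1 u) (hv : 1 ≤ Dw w1 v) (hw0 : w 0 = Dw w1 u) (hw1 : w 1 = Dw w1 u + Dw w1 v)
    (hmin : ∀ q : Polynomial K, Dw w1 v ≤ Dw w1 (v + Polynomial.aeval u q))
    {F G : MvPolynomial (Fin 2) K} (hG : Gen F G)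
    (h : Dw w F ≤ w 0) (h' : Dw w G ≤ w 1) :
    Dw w1 (sg u v F) = Dw w F ∧ Dw w1 (sg u v G) = Dw w G := by
  have hu0 : u ≠ 0 := by rintro rfl; simp [Dw] at hu
  have hv0 : v ≠ 0 := by rintro rfl; simp [Dw] at hv
  obtain ⟨p, q, γ, hp, hγ, hF, hGe, hDG⟩ := shape w (by omega) (by omega) hG h h'
  have hX0 : 1 ≤ Dw w (MvPolynomial.X 0 : MvPolynomial (Fin 2) K) := by rw [Dw_X]; omega
  constructor
  · rw [hF, sg_aeval, (Dw_aeval w1 hu p).1, (Dw_aeval w hX0 p).1, Dw_X, hw0]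
  · rw [hDG]
    have hs : sg u v G = MvPolynomial.C γ * (u * v) + Polynomial.aeval u q := by
      rw [hGe, map_add, sg_aeval]; simp [sg, MvPolynomial.algebraMap_eq]
    apply le_antisymm
    · have h1 : q.natDegree * w 0 ≤ w 1 := by
        have e := (Dw_aeval w hX0 q).1
        rw [Dw_X] at e
        rw [← e]
        have : Polynomial.aeval (MvPolynomial.X 0) q = G - MvPolynomial.C γ * MvPolynomial.X 1 := by
          rw [hGe]; ring
        rw [this]
        refine (Dw_sub_le _ _ _).trans (max_le h' ?_)
        rw [Dw_C_mul w hγ, Dw_X]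
      rw [hs]
      refine (Dw_add_le _ _ _).trans (max_le ?_ ?_)
      · rw [Dw_C_mul _ hγ, Dw_mul _ hu0 hv0, hw1]
      · rw [(Dw_aeval w1 hu q).1, ← hw0]; exact h1
    · have hq : Polynomial.aeval u q = Polynomial.aeval u q.divX * u + MvPolynomial.C (q.coeff 0) := by
        conv_lhs => rw [← Polynomial.divX_mul_X_add q]
        simp [MvPolynomial.algebraMap_eq]
      have hv' := hmin (Polynomial.C γ⁻¹ * q.divX)
      have hne : v + Polynomial.aeval u (Polynomial.C γ⁻¹ * q.divX) ≠ 0 := by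
        intro h0; rw [h0] at hv'; simp [Dw] at hv'; unfold Dw at hv; omega
      have hs2 : MvPolynomial.C γ * (u * (v + Polynomial.aeval u (Polynomial.C γ⁻¹ * q.divX))) =
          sg u v G - MvPolynomial.C (q.coeff 0) := by
        have : (MvPolynomial.C γ * MvPolynomial.C γ⁻¹ : MvPolynomial (Fin 2) K) = 1 := by
          rw [← MvPolynomial.C_mul, mul_inv_cancel₀ hγ, MvPolynomial.C_1]
        rw [hs, hq, map_mul, Polynomial.aeval_C, MvPolynomial.algebraMap_eq]
        linear_combination (u * Polynomial.aeval u q.divX) * this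
      have h3 := Dw_sub_le w1 (sg u v G) (MvPolynomial.C (q.coeff 0))
      rw [← hs2, Dw_C_mul _ hγ, Dw_mul _ hu0 hne, Dw_C] at h3
      rw [max_eq_left (Nat.zero_le _)] at h3
      omega

lemma Dw_add_lt (w : Fin 2 → ℕ) {a b : MvPolynomial (Fin 2) K} (h : Dw w a < Dw w b) :
    Dw w (a + b) = Dw w b := by
  unfold Dw at *; rw [map_add]; exact Polynomial.natDegree_add_eq_right_of_natDegree_lt h

lemma degree_transfer [CharZero K] {u v : MvPolynomial (Fin 2) K} {w : Fin 2 → ℕ}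
    (hu : 1 ≤ Dw w1 u) (hv : 1 ≤ Dw w1 v) (hw0 : w 0 = Dw w1 u) (hw1 : w 1 = Dw w1 u + Dw w1 v)
    (hmin : ∀ q : Polynomial K, Dw w1 v ≤ Dw w1 (v + Polynomial.aeval u q)) (N : ℕ) :
    ∀ {F G : MvPolynomial (Fin 2) K}, Gen F G → Dw w F ≤ Dw w G → Dw w F + Dw w G = N →
    Dw w1 (sg u v F) = Dw w F ∧ Dw w1 (sg u v G) = Dw w G := by
  have hw : ∀ i, 1 ≤ w i := by
    intro i; fin_cases i <;> simp <;> omega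
  induction N using Nat.strong_induction_on with
  | _ N ih =>
  intro F G hG hFG hN
  rcases jung w hw hG hFG with ⟨c, s, hc⟩ | ⟨h1, h2, h3⟩
  · have hF := Dw_pos_of_Jd w hw hG.Jd_ne
    set G' := G - MvPolynomial.C c * F ^ s with hG'
    have hgen : Gen F G' := hG.sub c s
    have hIH : Dw w1 (sg u v F) = Dw w F ∧ Dw w1 (sg u v G') = Dw w G' := by
      rcases le_total (Dw w F) (Dw w G') with hle | hle
      · exact ih _ (by omega) hgen hle rfl
      · exact (ih _ (by omega) hgen.swap hle rfl).symm
    refine ⟨hIH.1, ?_⟩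
    have hc0 : c ≠ 0 := by
      rintro rfl; simp [hG'] at hc
    have e1 : G = G' + MvPolynomial.C c * F ^ s := by rw [hG']; ring
    have e2 : Dw w G = s * Dw w F := by
      have h4 : MvPolynomial.C c * F ^ s = - G' + G := by rw [hG']; ring
      have h5 : Dw w (-G') < Dw w G := by rw [Dw_neg]; exact hc
      have h6 := Dw_add_lt w h5
      rw [← h4, Dw_C_mul w hc0, Dw_pow] at h6
      exact h6.symm
    have e3 : sg u v G = sg u v G' + MvPolynomial.C c * (sg u v F) ^ s := by
      conv_lhs => rw [e1]
      simp [sg, MvPolynomial.algebraMap_eq]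
    have e4 : Dw w1 (MvPolynomial.C c * (sg u v F) ^ s) = Dw w G := by
      rw [Dw_C_mul _ hc0, Dw_pow, hIH.1, e2]
    rw [e3, Dw_add_lt w1 (by rw [e4, hIH.2]; exact hc), e4]
  · exact base_case hu hv hw0 hw1 hmin hG h1 (by omega)

lemma tau_case [CharZero K] {u v : MvPolynomial (Fin 2) K}
    (hu : 1 ≤ Dw w1 u) (hv : 1 ≤ Dw w1 v)
    (hmin : ∀ q : Polynomial K, Dw w1 v ≤ Dw w1 (v + Polynomial.aeval u q)) :
    ∃ w : Fin 2 → ℕ, 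
    ∀ {F G : MvPolynomial (Fin 2) K}, Gen F G → Dw w F ≤ Dw w G →
    ∃ g', ((∃ q : Polynomial K, g' = sg u v G + Polynomial.aeval (sg u v F) q) ∨
      (∃ a b c : K, MvPolynomial.C c * sg u v F + MvPolynomial.C b ≠ 0 ∧
        g' * (MvPolynomial.C c * sg u v F + MvPolynomial.C b) = sg u v G + MvPolynomial.C a)) ∧
      Dw w1 g' < Dw w1 (sg u v G) := by
  refine ⟨![Dw w1 u, Dw w1 u + Dw w1 v], ?_⟩
  intro F G hG hFG
  set w : Fin 2 → ℕ := ![Dw w1 u, Dw w1 u + Dw w1 v] with hwd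
  have hw0 : w 0 = Dw w1 u := rfl
  have hw1 : w 1 = Dw w1 u + Dw w1 v := rfl
  have hw : ∀ i, 1 ≤ w i := by
    intro i; fin_cases i
    · exact hu
    · exact hu.trans (Nat.le_add_right _ _)
  have hu0 : u ≠ 0 := by rintro rfl; simp [Dw] at hu
  have hDT := @degree_transfer _ _ _ u v w hu hv hw0 hw1 hmin
  have hDG := hDT _ hG hFG rfl
  rcases jung w hw hG hFG with ⟨c, s, hc⟩ | ⟨h1, h2, h3⟩
  · set G' := G - MvPolynomial.C c * F ^ s with hG'
    have hgen : Gen F G' := hG.sub c s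
    have hIH : Dw w1 (sg u v F) = Dw w F ∧ Dw w1 (sg u v G') = Dw w G' := by
      rcases le_total (Dw w F) (Dw w G') with hle | hle
      · exact hDT _ hgen hle rfl
      · exact (hDT _ hgen.swap hle rfl).symm
    refine ⟨sg u v G', Or.inl ⟨Polynomial.monomial s (-c), ?_⟩, by rw [hIH.2, hDG.2]; exact hc⟩
    rw [Polynomial.aeval_monomial, hG']
    simp [sg, MvPolynomial.algebraMap_eq]
    ring
  · have h3' : Dw w G ≤ w 1 := by omega
    obtain ⟨p, q, γ, hp, hγ, hF, hGe, hDGe⟩ := shape w (hw 0) (by omega) hG h1 h3'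
    have hs : sg u v G = MvPolynomial.C γ * (u * v) + Polynomial.aeval u q := by
      rw [hGe, map_add, sg_aeval]; simp [sg, MvPolynomial.algebraMap_eq]
    have hq : Polynomial.aeval u q = Polynomial.aeval u q.divX * u + MvPolynomial.C (q.coeff 0) := by
      conv_lhs => rw [← Polynomial.divX_mul_X_add q]
      simp [MvPolynomial.algebraMap_eq]
    obtain ⟨α, hα, β, hpe⟩ := Polynomial.natDegree_eq_one.1 hp
    have hsF : sg u v F = MvPolynomial.C α * u + MvPolynomial.C β := by
      rw [hF, sg_aeval, ← hpe]; simp [MvPolynomial.algebraMap_eq]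
    have hden : MvPolynomial.C α⁻¹ * sg u v F + MvPolynomial.C (-(α⁻¹ * β)) = u := by
      have : (MvPolynomial.C α⁻¹ * MvPolynomial.C α : MvPolynomial (Fin 2) K) = 1 := by
        rw [← MvPolynomial.C_mul, inv_mul_cancel₀ hα, MvPolynomial.C_1]
      rw [hsF, MvPolynomial.C_neg, MvPolynomial.C_mul]
      linear_combination u * this
    set g' := MvPolynomial.C γ * v + Polynomial.aeval u q.divX
    have hg' : g' * u = sg u v G + MvPolynomial.C (-(q.coeff 0)) := by
      rw [hs, hq, MvPolynomial.C_neg]; ring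
    refine ⟨g', Or.inr ⟨-(q.coeff 0), -(α⁻¹ * β), α⁻¹, ?_, ?_⟩, ?_⟩
    · rw [hden]; exact hu0
    · rw [hden]; exact hg'
    · by_cases h0 : g' = 0
      · rw [h0, hDG.2, hDGe]; simp only [Dw, map_zero, Polynomial.natDegree_zero]; exact hw 1
      · have h5 := Dw_add_le w1 (sg u v G) (MvPolynomial.C (-(q.coeff 0)))
        rw [← hg', Dw_mul w1 h0 hu0, Dw_C, max_eq_left (Nat.zero_le _)] at h5
        omega

end

section
variable {K : Type*} [Field K]

lemma tauX_inj : Function.Injective (tauX K) := by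
  let σ : MvPolynomial (Fin 2) K →ₐ[K] FractionRing (MvPolynomial (Fin 2) K) :=
    MvPolynomial.aeval ![algebraMap (MvPolynomial (Fin 2) K) _ (MvPolynomial.X 0),
      algebraMap (MvPolynomial (Fin 2) K) _ (MvPolynomial.X 1) /
      algebraMap (MvPolynomial (Fin 2) K) _ (MvPolynomial.X 0)]
  have hX : algebraMap (MvPolynomial (Fin 2) K) (FractionRing (MvPolynomial (Fin 2) K))
      (MvPolynomial.X 0) ≠ 0 := by
    rw [Ne, FaithfulSMul.algebraMap_eq_zero_iff]; exact MvPolynomial.X_ne_zero 0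
  have h : σ.comp (tauX K) = IsScalarTower.toAlgHom K (MvPolynomial (Fin 2) K)
      (FractionRing (MvPolynomial (Fin 2) K)) := by
    ext i
    fin_cases i
    · simp [σ, tauX]
    · simp [σ, tauX]
      field_simp
  have h2 : Function.Injective (σ.comp (tauX K)) := by
    rw [h]; exact FaithfulSMul.algebraMap_injective _ _
  rw [AlgHom.coe_comp] at h2
  exact Function.Injective.of_comp h2

lemma sac_decomp (L : List (MvPolynomial (Fin 2) K →ₐ[K] MvPolynomial (Fin 2) K))
    (hL : ∀ ψ ∈ L, IsSimpleAffineContraction ψ) :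
    Function.Surjective (L.foldr AlgHom.comp (AlgHom.id K (MvPolynomial (Fin 2) K)) :
      MvPolynomial (Fin 2) K →ₐ[K] MvPolynomial (Fin 2) K) ∨
    ∃ φ A : MvPolynomial (Fin 2) K →ₐ[K] MvPolynomial (Fin 2) K,
      Function.Injective φ ∧ Function.Surjective A ∧
      L.foldr AlgHom.comp (AlgHom.id K (MvPolynomial (Fin 2) K)) = (φ.comp (tauX K)).comp A := by
  induction L with
  | nil => left; exact Function.surjective_id
  | cons ψ L ih =>
    rw [List.foldr_cons]
    have hψ := hL ψ List.mem_cons_self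
    rcases ih (fun x hx => hL x (List.mem_cons_of_mem _ hx)) with h | ⟨φ, A, h1, h2, h3⟩
    · rcases hψ with ⟨e, rfl⟩ | rfl
      · left
        exact e.surjective.comp h
      · right
        exact ⟨AlgHom.id K _, _, Function.injective_id, h, rfl⟩
    · right
      refine ⟨ψ.comp φ, A, ?_, h2, by rw [h3]; rfl⟩
      rcases hψ with ⟨e, rfl⟩ | rfl
      · exact e.injective.comp h1
      · exact tauX_inj.comp h1

lemma pair_eq (A : MvPolynomial (Fin 2) K →ₐ[K] MvPolynomial (Fin 2) K) :
    MvPolynomial.aeval ![A (MvPolynomial.X 0), A (MvPolynomial.X 1)] = A := by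
  ext i; fin_cases i <;> simp

/-- A form of the tau case in which the second factor is degree-minimal. -/
lemma tau_normalize {φ A : MvPolynomial (Fin 2) K →ₐ[K] MvPolynomial (Fin 2) K}
    (h1 : Function.Injective φ) (h2 : Function.Surjective A) :
    ∃ u v F G : MvPolynomial (Fin 2) K, 1 ≤ Dw w1 u ∧ 1 ≤ Dw w1 v ∧
      (∀ q : Polynomial K, Dw w1 v ≤ Dw w1 (v + Polynomial.aeval u q)) ∧ Gen F G ∧
      ((φ.comp (tauX K)).comp A) (MvPolynomial.X 0) = sg u v F ∧
      ((φ.comp (tauX K)).comp A) (MvPolynomial.X 1) = sg u v G := by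
  set u := φ (MvPolynomial.X 0) with hu
  set v0 := φ (MvPolynomial.X 1) with hv0
  obtain ⟨q, hq⟩ : ∃ q : Polynomial K, ∀ q' : Polynomial K,
      Dw w1 (v0 + Polynomial.aeval u q) ≤ Dw w1 (v0 + Polynomial.aeval u q') := by
    have := Function.argmin_le (fun q : Polynomial K => Dw w1 (v0 + Polynomial.aeval u q))
    exact ⟨_, fun q' => this q'⟩
  let B : MvPolynomial (Fin 2) K →ₐ[K] MvPolynomial (Fin 2) K :=
    MvPolynomial.aeval ![MvPolynomial.X 0, MvPolynomial.X 1 -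
      MvPolynomial.X 0 * Polynomial.aeval (MvPolynomial.X 0) q]
  let B' : MvPolynomial (Fin 2) K →ₐ[K] MvPolynomial (Fin 2) K :=
    MvPolynomial.aeval ![MvPolynomial.X 0, MvPolynomial.X 1 +
      MvPolynomial.X 0 * Polynomial.aeval (MvPolynomial.X 0) q]
  have hB0 : B (MvPolynomial.X 0) = MvPolynomial.X 0 := by simp [B]
  have hB : Function.Surjective B := by
    have : B.comp B' = AlgHom.id K _ := by
      ext i
      fin_cases i
      · simp [B, B']
      · simp only [B', AlgHom.comp_apply, MvPolynomial.aeval_X]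
        simp [← Polynomial.aeval_algHom_apply, hB0]
        simp [B]
    have h3 : Function.Surjective (B.comp B') := by rw [this]; exact Function.surjective_id
    exact Function.Surjective.of_comp h3
  have hcomp : φ.comp (tauX K) = (sg u (v0 + Polynomial.aeval u q)).comp B := by
    ext i
    fin_cases i
    · simp [tauX, sg, B, hu]
    · simp only [B, AlgHom.comp_apply, MvPolynomial.aeval_X]
      simp [tauX, sg_aeval]
      simp [sg, ← hu, ← hv0]
      rw [mul_add, MvPolynomial.coeff_add]
      ring
  refine ⟨u, v0 + Polynomial.aeval u q, B (A (MvPolynomial.X 0)), B (A (MvPolynomial.X 1)),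
    ?_, ?_, ?_, ?_, ?_, ?_⟩
  · by_contra hc
    have h0 : u.totalDegree = 0 := by rw [← Dw_one]; change Dw w1 u = 0; omega
    rw [MvPolynomial.totalDegree_eq_zero_iff_eq_C] at h0
    have h3 : φ (MvPolynomial.X 0) = φ (MvPolynomial.C (MvPolynomial.coeff 0 u)) := by
      rw [← hu, ← MvPolynomial.algebraMap_eq, AlgHom.commutes, MvPolynomial.algebraMap_eq, ← h0]
    have h4 := congrArg (MvPolynomial.pderiv 0) (h1 h3)
    simp at h4
  · by_contra hc
    set v := v0 + Polynomial.aeval u q with hv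
    have h0 : v.totalDegree = 0 := by rw [← Dw_one]; change Dw w1 v = 0; omega
    rw [MvPolynomial.totalDegree_eq_zero_iff_eq_C] at h0
    have h3 : φ (MvPolynomial.X 1 + Polynomial.aeval (MvPolynomial.X 0) q) =
        φ (MvPolynomial.C (MvPolynomial.coeff 0 v)) := by
      rw [map_add, ← Polynomial.aeval_algHom_apply, ← hu, ← hv0, ← hv,
        ← MvPolynomial.algebraMap_eq, AlgHom.commutes, MvPolynomial.algebraMap_eq, ← h0]
    have h4 := congrArg (MvPolynomial.pderiv 1) (h1 h3)
    rw [map_add, Derivation.map_aeval] at h4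
    simp [MvPolynomial.pderiv_X] at h4
  · intro q'
    have := hq (q + q')
    rwa [map_add, ← add_assoc] at this
  · unfold Gen
    have := pair_eq (B.comp A)
    simp only [AlgHom.comp_apply] at this
    rw [this]
    exact hB.comp h2
  · rw [hcomp]; rfl
  · rw [hcomp]; rfl

end

/-- Let `K` be a field of characteristic 0 and `(u, v)` a birational
morphism of the affine plane over `K` with `deg u + deg v > 2`.  If the morphism
`x ↦ u, y ↦ v` is a product of simple affine contractions, then the sum of total degrees
can be decreased by a single elementary transformation (ET1)–(ET3). -/
theorem birational_prodSAC_degree_reduction {K : Type*} [Field K] [CharZero K]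
    (u v : MvPolynomial (Fin 2) K)
    (hbir : IsBirationalPair u v)
    (hdeg : 2 < u.totalDegree + v.totalDegree)
    (hprod : IsProdOfSAC (MvPolynomial.aeval ![u, v])) :
    ∃ p' : MvPolynomial (Fin 2) K × MvPolynomial (Fin 2) K,
      ElemTrans (u, v) p' ∧
      p'.1.totalDegree + p'.2.totalDegree < u.totalDegree + v.totalDegree := by
  
  have hD : ∀ f : MvPolynomial (Fin 2) K, f.totalDegree = Dw w1 f := fun f => (Dw_one f).symm
  simp only [hD] at *
  -- it suffices to transform one of the components
  have suff : (∃ g', ((∃ q : Polynomial K, g' = v + Polynomial.aeval u q) ∨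
      (∃ a b c : K, MvPolynomial.C c * u + MvPolynomial.C b ≠ 0 ∧
        g' * (MvPolynomial.C c * u + MvPolynomial.C b) = v + MvPolynomial.C a)) ∧
      Dw w1 g' < Dw w1 v) ∨ (∃ g', ((∃ q : Polynomial K, g' = u + Polynomial.aeval v q) ∨
      (∃ a b c : K, MvPolynomial.C c * v + MvPolynomial.C b ≠ 0 ∧
        g' * (MvPolynomial.C c * v + MvPolynomial.C b) = u + MvPolynomial.C a)) ∧
      Dw w1 g' < Dw w1 u) → ∃ p' : MvPolynomial (Fin 2) K × MvPolynomial (Fin 2) K,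
      ElemTrans (u, v) p' ∧ Dw w1 p'.1 + Dw w1 p'.2 < Dw w1 u + Dw w1 v := by
    rintro (⟨g', h, hlt⟩ | ⟨g', h, hlt⟩)
    · refine ⟨(u, g'), ?_, by simpa using hlt⟩
      rcases h with ⟨q, hq⟩ | ⟨a, b, c, h1, h2⟩
      · exact Or.inr (Or.inr (Or.inr (Or.inl ⟨q, by rw [hq]⟩)))
      · exact Or.inr (Or.inl ⟨a, b, c, h1, ⟨g', by rw [← h2]; ring⟩, h2, rfl⟩)
    · refine ⟨(g', v), ?_, by simpa using hlt⟩
      rcases h with ⟨q, hq⟩ | ⟨a, b, c, h1, h2⟩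
      · exact Or.inr (Or.inr (Or.inl ⟨q, by rw [hq]⟩))
      · exact Or.inl ⟨a, b, c, h1, ⟨g', by rw [← h2]; ring⟩, h2, rfl⟩
  apply suff
  obtain ⟨L, hL, hφ⟩ := hprod
  rcases sac_decomp L hL with h | ⟨φ, A, h1, h2, h3⟩
  · rw [← hφ] at h
    have hgen : Gen u v := h
    have hw : ∀ i, 1 ≤ w1 i := fun _ => le_rfl
    have hA : ∀ {F G : MvPolynomial (Fin 2) K}, Gen F G → Dw w1 F ≤ Dw w1 G →
        2 < Dw w1 F + Dw w1 G →
        ∃ g', ((∃ q : Polynomial K, g' = G + Polynomial.aeval F q) ∨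
        (∃ a b c : K, MvPolynomial.C c * F + MvPolynomial.C b ≠ 0 ∧
        g' * (MvPolynomial.C c * F + MvPolynomial.C b) = G + MvPolynomial.C a)) ∧
        Dw w1 g' < Dw w1 G := by
      intro F G hG hle hd
      rcases jung w1 hw hG hle with ⟨c, s, hc⟩ | h
      · refine ⟨_, Or.inl ⟨Polynomial.monomial s (-c), ?_⟩, hc⟩
        rw [Polynomial.aeval_monomial, MvPolynomial.algebraMap_eq, MvPolynomial.C_neg]
        ring
      · simp only [w1] at h hd
        omega
    rcases le_total (Dw w1 u) (Dw w1 v) with hle | hle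
    · exact Or.inl (hA hgen hle hdeg)
    · exact Or.inr (hA hgen.swap hle (by omega))
  · rw [← hφ] at h3
    obtain ⟨u', v', F, G, hu, hv, hmin, hgen, e1, e2⟩ := tau_normalize h1 h2
    rw [← h3, MvPolynomial.aeval_X] at e1 e2
    change u = _ at e1
    change v = _ at e2
    obtain ⟨w, hw⟩ := tau_case hu hv hmin
    rw [e1, e2]
    rcases le_total (Dw w F) (Dw w G) with hle | hle
    · exact Or.inl (hw hgen hle)
    · exact Or.inr (hw hgen.swap hle)
end

section
/- Let K be a field of characteristic 0. If a pair (u,v) ∈ K[x,y]² can be taken by a finite sequence of elementary transformations (ET1), (ET1'), (ET2), (ET2'), (ET3) to a pair (u'',v'') with deg u'' + deg v'' < deg u + deg v (total degrees), then there is a single elementary transformation among (ET1), (ET1'), (ET2), (ET2'), (ET3) taking (u,v) to a pair (u',v') with deg u' + deg v' < deg u + deg v. -/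
namespace PeakRed

open MvPolynomial

variable {K : Type*} [Field K]

local notation "PP" => MvPolynomial (Fin 2) K

lemma deg_zero (v : PP) (h : v.totalDegree = 0) : ∃ c, v = C c :=
  ⟨_, totalDegree_eq_zero_iff_eq_C.mp h⟩

lemma deg_add_C (u : PP) (a : K) : (u + C a).totalDegree = u.totalDegree := by
  by_cases h : u.totalDegree = 0
  · obtain ⟨c, rfl⟩ := deg_zero u h
    rw [← C_add, totalDegree_C, totalDegree_C]
  · apply totalDegree_add_eq_left_of_totalDegree_lt
    rw [totalDegree_C]; omega

lemma deg_C_mul (u : PP) (a : K) (ha : a ≠ 0) : (C a * u).totalDegree = u.totalDegree := by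
  by_cases h : u = 0
  · simp [h]
  · rw [totalDegree_mul_of_isDomain (by simpa using ha) h]; simp

lemma deg_aff (u : PP) (a b : K) (ha : a ≠ 0) :
    (C a * u + C b).totalDegree = u.totalDegree := by
  rw [deg_add_C, deg_C_mul _ _ ha]

lemma deg_C_mul_le (u : PP) (a : K) : (C a * u).totalDegree ≤ u.totalDegree := by
  refine (totalDegree_mul _ _).trans ?_
  simp

lemma aeval_aux (v : PP) (hv : v.totalDegree ≠ 0) (n : ℕ) : ∀ q : Polynomial K, q.natDegree = n →
    (q ≠ 0 → Polynomial.aeval v q ≠ 0) ∧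
    (Polynomial.aeval v q).totalDegree = q.natDegree * v.totalDegree := by
  induction n with
  | zero =>
    intro q hq
    rw [Polynomial.eq_C_of_natDegree_eq_zero hq]
    simp [MvPolynomial.algebraMap_eq]
  | succ n ih =>
    intro q hq
    have h1 : q.divX.natDegree = n := by rw [Polynomial.natDegree_divX_eq_natDegree_tsub_one]; omega
    have h2 : q.divX ≠ 0 := by
      intro h
      have := Polynomial.divX_mul_X_add q
      rw [h] at this
      rw [← this] at hq
      simp at hq
    obtain ⟨h3, h4⟩ := ih _ h1
    have h5 : Polynomial.aeval v q = Polynomial.aeval v q.divX * v + C (q.coeff 0) := by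
      conv_lhs => rw [← Polynomial.divX_mul_X_add q]
      simp [MvPolynomial.algebraMap_eq]
    have hv0 : v ≠ 0 := by rintro rfl; simp at hv
    have h6 : (Polynomial.aeval v q).totalDegree = q.natDegree * v.totalDegree := by
      rw [h5, deg_add_C, totalDegree_mul_of_isDomain (h3 h2) hv0, h4, h1, hq]; ring
    refine ⟨fun _ h => ?_, h6⟩
    rw [h, hq] at h6
    simp at h6
    omega

lemma deg_aeval (v : PP) (q : Polynomial K) :
    (Polynomial.aeval v q).totalDegree = q.natDegree * v.totalDegree := by
  by_cases hv : v.totalDegree = 0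
  · obtain ⟨c, rfl⟩ := deg_zero v hv
    rw [hv, ← MvPolynomial.algebraMap_eq, Polynomial.aeval_algebraMap_apply,
      MvPolynomial.algebraMap_eq, totalDegree_C]
    simp
  · exact (aeval_aux v hv _ q rfl).2

lemma lin_of (q : Polynomial K) (h : q.natDegree = 1) :
    ∃ a b : K, a ≠ 0 ∧ ∀ v : PP, Polynomial.aeval v q = C a * v + C b := by
  obtain ⟨a, b, hab⟩ := Polynomial.exists_eq_X_add_C_of_natDegree_le_one h.le
  refine ⟨a, b, ?_, ?_⟩
  · rintro rfl
    rw [hab] at h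
    simp at h
  · intro v
    rw [hab]; simp [MvPolynomial.algebraMap_eq]

lemma aeval_lin (v : PP) (a b : K) :
    Polynomial.aeval v (Polynomial.C a * Polynomial.X + Polynomial.C b) = C a * v + C b := by
  simp [MvPolynomial.algebraMap_eq]

lemma divs (q : Polynomial K) (b a : K) : ∃ (r : Polynomial K) (s : K), ∀ v : PP,
    Polynomial.aeval v q + C a = Polynomial.aeval v r * (v + C b) + C s := by
  refine ⟨q /ₘ (Polynomial.X - Polynomial.C (-b)), q.eval (-b) + a, fun v => ?_⟩
  conv_lhs => rw [← Polynomial.modByMonic_add_div q (Polynomial.X - Polynomial.C (-b))]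
  rw [Polynomial.modByMonic_X_sub_C_eq_C_eval]
  simp [MvPolynomial.algebraMap_eq]
  ring

lemma aeval_affine (v : PP) (a b : K) (ha : a ≠ 0) (q : Polynomial K) : ∃ r : Polynomial K,
    Polynomial.aeval v q = Polynomial.aeval (C a * v + C b) r := by
  refine ⟨q.comp (Polynomial.C a⁻¹ * Polynomial.X + Polynomial.C (-(a⁻¹ * b))), ?_⟩
  rw [Polynomial.aeval_comp, aeval_lin]
  congr 1
  have : (C a⁻¹ : PP) * C a = 1 := by rw [← C_mul, inv_mul_cancel₀ ha, C_1]
  congr 1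
  simp only [map_neg, map_mul]
  linear_combination (-v) * this

/-- half of irreducibility -/
def HIrr (u v : PP) : Prop :=
  (∀ q : Polynomial K, u.totalDegree ≤ (u + Polynomial.aeval v q).totalDegree) ∧
  (∀ (w : PP) (a b : K), v + C b ≠ 0 → w * (v + C b) = u + C a → u.totalDegree ≤ w.totalDegree)

lemma HIrr.affine {u v : PP} (h : HIrr u v) (a b c d : K) (ha : a ≠ 0) (hc : c ≠ 0) :
    HIrr (C a * u + C b) (C c * v + C d) := by
  have hA : (C a⁻¹ : PP) * C a = 1 := by rw [← C_mul, inv_mul_cancel₀ ha, C_1]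
  have hC : (C c⁻¹ : PP) * C c = 1 := by rw [← C_mul, inv_mul_cancel₀ hc, C_1]
  refine ⟨fun q => ?_, fun w s t h0 hw => ?_⟩
  · rw [deg_aff _ _ _ ha]
    refine (h.1 ((Polynomial.C a⁻¹ * q).comp (Polynomial.C c * Polynomial.X + Polynomial.C d))).trans_eq ?_
    rw [Polynomial.aeval_comp, aeval_lin, ← deg_aff _ a b ha]
    congr 1
    simp only [map_mul, Polynomial.aeval_C, MvPolynomial.algebraMap_eq]
    linear_combination (Polynomial.aeval (C c * v + C d) q) * hA
  · rw [deg_aff _ _ _ ha]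
    have e : C c * (v + C (c⁻¹ * (d + t))) = C c * v + C d + C t := by
      simp only [map_mul, map_add]
      linear_combination (C d + C t) * hC
    have := h.2 (C (a⁻¹ * c) * w) (a⁻¹ * (b + s)) (c⁻¹ * (d + t))
      (fun h1 => h0 (by rw [← e, h1, mul_zero])) ?_
    · rwa [deg_C_mul _ _ (by simp [ha, hc])] at this
    · rw [← e] at hw
      simp only [map_mul, map_add] at hw ⊢
      linear_combination C a⁻¹ * hw + u * hA

inductive T (d : ℕ) : PP → PP → Prop
  | base (u v : PP) : u.totalDegree + v.totalDegree = d → HIrr u v → HIrr v u → T d u v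
  | up (u v : PP) (q : Polynomial K) : T d u v →
      u.totalDegree < (Polynomial.aeval v q).totalDegree → T d (u + Polynomial.aeval v q) v
  | swap (u v : PP) : T d u v → T d v u

lemma T.le {d : ℕ} {u v : PP} (h : T d u v) : d ≤ u.totalDegree + v.totalDegree := by
  induction h with
  | base u v h _ _ => omega
  | up u v q _ h ih => rw [totalDegree_add_eq_right_of_totalDegree_lt h]; omega
  | swap u v _ ih => omega

lemma T.affine {d : ℕ} {u v : PP} (h : T d u v) : ∀ (a b e f : K), a ≠ 0 → e ≠ 0 →
    T d (C a * u + C b) (C e * v + C f) := by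
  induction h with
  | base u v h h1 h2 =>
    intro a b e f ha he
    exact T.base _ _ (by rw [deg_aff _ _ _ ha, deg_aff _ _ _ he, h])
      (h1.affine _ _ _ _ ha he) (h2.affine _ _ _ _ he ha)
  | up u v q _ h ih =>
    intro a b e f ha he
    obtain ⟨r, hr⟩ := aeval_affine v e f he q
    have := T.up _ _ (Polynomial.C a * r) (ih a b e f ha he) (by
      rw [deg_aff _ _ _ ha, map_mul, Polynomial.aeval_C, MvPolynomial.algebraMap_eq,
        deg_C_mul _ _ ha, ← hr]
      exact h)
    convert this using 1
    rw [map_mul, Polynomial.aeval_C, MvPolynomial.algebraMap_eq, ← hr]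
    ring
  | swap u v _ ih =>
    intro a b e f ha he
    exact (ih e f a b he ha).swap

lemma T.affine1 {d : ℕ} {u v : PP} (h : T d u v) (a b : K) (ha : a ≠ 0) :
    T d (C a * u + C b) v := by
  simpa using h.affine a b 1 0 ha one_ne_zero

lemma T.affine2 {d : ℕ} {u v : PP} (h : T d u v) (a b : K) (ha : a ≠ 0) :
    T d u (C a * v + C b) := by
  simpa using h.affine 1 0 a b one_ne_zero ha

def HClosed (d : ℕ) (u v : PP) : Prop :=
  (∀ q : Polynomial K, T d (u + Polynomial.aeval v q) v) ∧
  (∀ (w : PP) (a b : K), v + C b ≠ 0 → w * (v + C b) = u + C a → T d w v)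

lemma deg_mul_eq {w z u : PP} (hu : u ≠ 0) (h : w * z = u) :
    w.totalDegree + z.totalDegree = u.totalDegree := by
  have hw : w ≠ 0 := by rintro rfl; simp at h; exact hu h.symm
  have hz : z ≠ 0 := by rintro rfl; simp at h; exact hu h.symm
  rw [← h, totalDegree_mul_of_isDomain hw hz]

lemma ne_of_deg {u : PP} (h : u.totalDegree ≠ 0) (a : K) : u + C a ≠ 0 := by
  intro h1
  rw [← deg_add_C u a, h1] at h
  simp at h

lemma inv_one {a : K} (ha : a ≠ 0) : (C a⁻¹ : PP) * C a = 1 := by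
  rw [← C_mul, inv_mul_cancel₀ ha, C_1]

/-- If `natDegree = 1` is forced. -/
lemma forced {n m : ℕ} (hn : n ≠ 0) (h : n * m ≤ m) (hm : m ≠ 0) : n = 1 := by
  have : n ≤ 1 := by
    by_contra h1
    nlinarith [Nat.pos_of_ne_zero hm]
  omega

lemma base_irr {u v : PP} (h1 : HIrr u v) (h2 : HIrr v u) (q : Polynomial K)
    (hv : v.totalDegree ≠ 0) (hq : q.natDegree ≠ 0)
    (hd : (Polynomial.aeval v q).totalDegree ≤ u.totalDegree)
    (he : (u + Polynomial.aeval v q).totalDegree = u.totalDegree) :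
    HIrr (u + Polynomial.aeval v q) v ∧ HIrr v (u + Polynomial.aeval v q) := by
  have hd' := hd
  rw [deg_aeval] at hd'
  have hvu : v.totalDegree ≤ u.totalDegree :=
    le_trans (Nat.le_mul_of_pos_left _ (Nat.pos_of_ne_zero hq)) hd'
  refine ⟨⟨fun r => ?_, fun w a b h0 hw => ?_⟩, ⟨fun g => ?_, fun w a b h0 hw => ?_⟩⟩
  · rw [he, add_assoc, ← map_add]
    exact h1.1 _
  · exfalso
    obtain ⟨r, s, hrs⟩ := divs q b a
    have hrs := hrs v
    have e : (w - Polynomial.aeval v r) * (v + C b) = u + C s := by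
      linear_combination hw + hrs
    have := h1.2 _ _ _ h0 e
    have h3 := deg_mul_eq (ne_of_deg (by omega) s) e
    rw [deg_add_C, deg_add_C] at h3
    omega
  · by_contra hlt
    push Not at hlt
    have h3 : (Polynomial.aeval (u + Polynomial.aeval v q) g).totalDegree = v.totalDegree := by
      by_contra hne
      rcases lt_or_gt_of_ne hne with h | h
      · rw [totalDegree_add_eq_left_of_totalDegree_lt h] at hlt; omega
      · rw [totalDegree_add_eq_right_of_totalDegree_lt h] at hlt; omega
    rw [deg_aeval, he] at h3
    have hg : g.natDegree ≠ 0 := by intro h; rw [h] at h3; omega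
    have huv : u.totalDegree ≤ v.totalDegree :=
      le_trans (Nat.le_mul_of_pos_left _ (Nat.pos_of_ne_zero hg)) h3.le
    have hee : u.totalDegree = v.totalDegree := le_antisymm huv hvu
    rw [hee] at h3 hd'
    obtain ⟨α, β, hα, hq⟩ := lin_of q (forced hq hd' hv)
    obtain ⟨γ, δ, hγ, hg⟩ := lin_of g (forced hg h3.le hv)
    rw [hg, hq] at hlt
    have h4 := h1.1 (Polynomial.C (α + γ⁻¹) * Polynomial.X + Polynomial.C (β + γ⁻¹ * δ))
    rw [aeval_lin] at h4
    rw [← deg_C_mul _ _ (inv_ne_zero hγ)] at hlt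
    have e : u + (C (α + γ⁻¹) * v + C (β + γ⁻¹ * δ)) =
        C γ⁻¹ * (v + (C γ * (u + (C α * v + C β)) + C δ)) := by
      simp only [map_add, map_mul]
      linear_combination (-(u + (C α * v + C β))) * inv_one hγ
    rw [e] at h4
    omega
  · exfalso
    have h3 := deg_mul_eq (ne_of_deg hv a) hw
    rw [deg_add_C, deg_add_C, he] at h3
    obtain ⟨k, rfl⟩ := deg_zero w (by omega)
    have hee : u.totalDegree = v.totalDegree := by omega
    rw [hee] at hd'
    obtain ⟨α, β, hα, hq⟩ := lin_of q (forced hq hd' hv)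
    have hk : k ≠ 0 := by
      rintro rfl
      exact ne_of_deg hv a (by rw [← hw]; simp)
    rw [hq] at hw
    have h4 := h1.1 (Polynomial.C (α - k⁻¹) * Polynomial.X + Polynomial.C 0)
    rw [aeval_lin] at h4
    have e : u + (C (α - k⁻¹) * v + C 0) = C (k⁻¹ * a - β - b) := by
      simp only [map_sub, map_mul, map_zero]
      linear_combination C k⁻¹ * hw - (u + C α * v + C β + C b) * inv_one hk
    rw [e, totalDegree_C] at h4
    omega

lemma base_closed {d : ℕ} {u v : PP} (h : u.totalDegree + v.totalDegree = d)
    (h1 : HIrr u v) (h2 : HIrr v u) : HClosed d u v := by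
  have hT := T.base u v h h1 h2
  refine ⟨fun q => ?_, fun w a b h0 hw => ?_⟩
  · by_cases hlt : u.totalDegree < (Polynomial.aeval v q).totalDegree
    · exact T.up _ _ _ hT hlt
    push Not at hlt
    have he : (u + Polynomial.aeval v q).totalDegree = u.totalDegree :=
      le_antisymm ((totalDegree_add _ _).trans (max_le le_rfl hlt)) (h1.1 q)
    by_cases h0 : (Polynomial.aeval v q).totalDegree = 0
    · obtain ⟨c, hc⟩ := deg_zero _ h0
      rw [hc]
      simpa using hT.affine1 1 c one_ne_zero
    rw [deg_aeval] at h0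
    obtain ⟨h3, h4⟩ := base_irr h1 h2 q (right_ne_zero_of_mul h0) (left_ne_zero_of_mul h0) hlt he
    exact T.base _ _ (by omega) h3 h4
  · have h3 := h1.2 w a b h0 hw
    by_cases hu : u + C a = 0
    · have hw0 : w = 0 := by
        rw [hu] at hw
        exact (mul_eq_zero.mp hw).resolve_right h0
      have := hT.affine1 1 a one_ne_zero
      rw [C_1, one_mul, hu] at this
      rwa [hw0]
    · have h4 := deg_mul_eq hu hw
      rw [deg_add_C, deg_add_C] at h4
      obtain ⟨c, rfl⟩ := deg_zero v (by omega)
      have hcb : c + b ≠ 0 := by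
        intro h; apply h0; rw [← C_add, h, C_0]
      have := hT.affine1 (c + b)⁻¹ ((c + b)⁻¹ * a) (inv_ne_zero hcb)
      convert this using 1
      have h5 := inv_one hcb
      rw [← C_add] at hw
      rw [C_mul]
      linear_combination C (c + b)⁻¹ * hw - w * h5

lemma up_closed {d : ℕ} {u v : PP} (q : Polynomial K) (hT : T d u v)
    (hlt : u.totalDegree < (Polynomial.aeval v q).totalDegree)
    (IH : ∀ u' v' : PP, u'.totalDegree + v'.totalDegree ≤ u.totalDegree + v.totalDegree →
      T d u' v' → HClosed d u' v' ∧ HClosed d v' u') :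
    HClosed d (u + Polynomial.aeval v q) v ∧ HClosed d v (u + Polynomial.aeval v q) := by
  have hT1 := T.up _ _ _ hT hlt
  have hC := IH u v le_rfl hT
  have he := totalDegree_add_eq_right_of_totalDegree_lt hlt
  have hqv := deg_aeval v q
  have hne : q.natDegree * v.totalDegree ≠ 0 := by omega
  have hq := left_ne_zero_of_mul hne
  have hv := right_ne_zero_of_mul hne
  have hle : v.totalDegree ≤ q.natDegree * v.totalDegree :=
    Nat.le_mul_of_pos_left _ (Nat.pos_of_ne_zero hq)
  refine ⟨⟨fun r => ?_, fun w a b h0 hw => ?_⟩, ⟨fun g => ?_, fun w a b h0 hw => ?_⟩⟩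
  · rw [add_assoc, ← map_add]
    exact hC.1.1 _
  · obtain ⟨r, s, hrs⟩ := divs q b a
    have hrs := hrs v
    have e : (w - Polynomial.aeval v r) * (v + C b) = u + C s := by
      linear_combination hw + hrs
    have h3 := hC.1.2 _ _ _ h0 e
    have h4 : (w - Polynomial.aeval v r).totalDegree ≤ u.totalDegree := by
      by_cases hu : u + C s = 0
      · rw [hu] at e
        rw [(mul_eq_zero.mp e).resolve_right h0]
        simp
      · have h3 := deg_mul_eq hu e
        rw [deg_add_C, deg_add_C] at h3
        omega
    have := (IH _ v (by omega) h3).1.1 r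
    simpa using this
  · apply T.swap
    by_cases hg : v.totalDegree <
      (Polynomial.aeval (u + Polynomial.aeval v q) g).totalDegree
    · exact (T.up _ _ g hT1.swap hg).swap
    by_cases h0 : (Polynomial.aeval (u + Polynomial.aeval v q) g).totalDegree = 0
    · obtain ⟨c, hc⟩ := deg_zero _ h0
      rw [hc]
      simpa using hT1.affine2 1 c one_ne_zero
    rw [deg_aeval, he, hqv] at hg h0
    push Not at hg
    have hg0 := left_ne_zero_of_mul h0
    have h5 : q.natDegree * v.totalDegree ≤ v.totalDegree :=
      le_trans (Nat.le_mul_of_pos_left _ (Nat.pos_of_ne_zero hg0)) hg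
    have hq1 := forced hq h5 hv
    rw [hq1, one_mul] at hg hqv
    rw [hqv] at hlt
    obtain ⟨α, β, hα, hq⟩ := lin_of q hq1
    obtain ⟨γ, δ, hγ, hg⟩ := lin_of g (forced hg0 hg hv)
    rw [hg, hq]
    by_cases hε : 1 + γ * α = 0
    · have h6 := hT.swap.affine α β γ (γ * β + δ) hα hγ
      have h7 := (IH _ _ (by rw [deg_aff _ _ _ hα, deg_aff _ _ _ hγ]; omega) h6).1.1
        (Polynomial.C γ⁻¹ * Polynomial.X + Polynomial.C (-(γ⁻¹ * (γ * β + δ))))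
      rw [aeval_lin] at h7
      have hε' : (1 : PP) + C γ * C α = 0 := by rw [← C_1, ← C_mul, ← C_add, hε, C_0]
      convert h7 using 1
      · simp only [map_add, map_mul, map_neg]
        linear_combination (-u) * inv_one hγ
      · simp only [map_add, map_mul]
        linear_combination v * hε'
    · set ε := 1 + γ * α with hεd
      have hε' : (C ε : PP) = 1 + C γ * C α := by rw [hεd]; simp
      have hi := inv_one (K := K) hε
      have h6 := hC.2.1 (Polynomial.C (ε⁻¹ * γ) * Polynomial.X + Polynomial.C 0)
      rw [aeval_lin] at h6
      have hdeg : (v + (C (ε⁻¹ * γ) * u + C 0)).totalDegree ≤ v.totalDegree := by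
        refine (totalDegree_add _ _).trans (max_le le_rfl ?_)
        rw [deg_add_C]
        exact (deg_C_mul_le _ _).trans hlt.le
      have h7 := h6.swap.affine ε⁻¹ 0 ε (γ * β + δ) (inv_ne_zero hε) hε
      have h8 := (IH _ _ (by
        rw [deg_aff _ _ _ hε, deg_aff _ _ _ (inv_ne_zero hε)]; omega) h7).1.1
        (Polynomial.C (α * ε⁻¹) * Polynomial.X +
          Polynomial.C (β - α * ε⁻¹ * (γ * β + δ)))
      rw [aeval_lin] at h8
      convert h8 using 1
      · simp only [map_add, map_mul, map_zero, map_sub]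
        linear_combination (-C α * v - u - C α * C ε⁻¹ * C γ * u) * hi + C ε⁻¹ * u * hε'
      · simp only [map_add, map_mul, map_zero]
        linear_combination (-v) * hε' - C γ * u * hi
  · have h3 := deg_mul_eq (ne_of_deg hv a) hw
    rw [deg_add_C, deg_add_C, he, hqv] at h3
    obtain ⟨k, rfl⟩ := deg_zero w (by omega)
    have hq1 := forced hq (by omega) hv
    rw [hq1, one_mul] at hqv
    obtain ⟨α, β, hα, hq⟩ := lin_of q hq1
    have hk : k ≠ 0 := by
      rintro rfl
      exact ne_of_deg hv a (by rw [← hw]; simp)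
    rw [hq] at hw
    have e : u = C (k⁻¹ - α) * v + C (k⁻¹ * a - β - b) := by
      simp only [map_sub, map_mul]
      linear_combination C k⁻¹ * hw - (u + C α * v + C β + C b) * inv_one hk
    have hz : k⁻¹ - α = 0 := by
      by_contra hz
      have := deg_aff v _ (k⁻¹ * a - β - b) hz
      rw [← e] at this
      omega
    rw [hz, C_0, zero_mul, zero_add] at e
    set c := k⁻¹ * a - β - b
    rw [hq]
    have := hT.affine 1 (k - c) α (β + c) one_ne_zero hα
    convert this using 1
    · rw [e]; simp
    · rw [e, C_add]; ring

lemma closed (d n : ℕ) : ∀ u v : PP, u.totalDegree + v.totalDegree ≤ n → T d u v →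
    HClosed d u v ∧ HClosed d v u := by
  induction n using Nat.strong_induction_on with
  | _ n IH =>
    intro u v hn hT
    induction hT with
    | base u v h h1 h2 => exact ⟨base_closed h h1 h2, base_closed (by omega) h2 h1⟩
    | up u v q hT hlt _ =>
      have he := totalDegree_add_eq_right_of_totalDegree_lt hlt
      exact up_closed q hT hlt (IH _ (by omega))
    | swap u v hT ih => exact (ih (by omega)).symm

lemma et1 {d : ℕ} {u v w : PP} (hT : T d u v) (a b c : K) (h0 : C c * v + C b ≠ 0)
    (hw : w * (C c * v + C b) = u + C a) : T d w v := by
  by_cases hc : c = 0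
  · subst hc
    have hb : b ≠ 0 := by rintro rfl; simp at h0
    convert hT.affine1 b⁻¹ (b⁻¹ * a) (inv_ne_zero hb) using 1
    rw [C_0] at hw
    rw [C_mul]
    linear_combination C b⁻¹ * hw - w * inv_one hb
  · have hi := inv_one (K := K) hc
    have e : C c * (v + C (c⁻¹ * b)) = C c * v + C b := by
      rw [C_mul]; linear_combination C b * hi
    have := (closed d _ u v le_rfl hT).1.2 (C c * w) a (c⁻¹ * b)
      (fun h => h0 (by rw [← e, h, mul_zero])) (by rw [← hw, ← e]; ring)
    convert this.affine1 c⁻¹ 0 (inv_ne_zero hc) using 1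
    rw [C_0]
    linear_combination (-w) * hi

lemma et {d : ℕ} {p p' : PP × PP} (hT : T d p.1 p.2) (h : ElemTrans p p') : T d p'.1 p'.2 := by
  rcases h with ⟨a, b, c, h0, -, h1, h2⟩ | ⟨a, b, c, h0, -, h1, h2⟩ | ⟨q, rfl⟩ | ⟨q, rfl⟩ | rfl
  · rw [h2]; exact et1 hT a b c h0 h1
  · rw [h2]; exact (et1 hT.swap a b c h0 h1).swap
  · exact (closed d _ _ _ le_rfl hT).1.1 q
  · exact ((closed d _ _ _ le_rfl hT).2.1 q).swap
  · exact hT.swap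

end PeakRed

/-- **peak reduction.** If a pair `(u, v)` can be taken by a finite sequence
of elementary transformations (ET1)–(ET3) to a pair whose sum of total degrees is smaller,
then a single elementary transformation already decreases the sum of total degrees. -/
theorem peak_reduction {K : Type*} [Field K] [CharZero K]
    (u v u'' v'' : MvPolynomial (Fin 2) K)
    (hseq : Relation.ReflTransGen ElemTrans (u, v) (u'', v''))
    (hlt : u''.totalDegree + v''.totalDegree < u.totalDegree + v.totalDegree) :
    ∃ p' : MvPolynomial (Fin 2) K × MvPolynomial (Fin 2) K,
      ElemTrans (u, v) p' ∧
      p'.1.totalDegree + p'.2.totalDegree < u.totalDegree + v.totalDegree := by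
  by_contra hcon
  push Not at hcon
  have hT : PeakRed.T (u.totalDegree + v.totalDegree) u v := by
    refine PeakRed.T.base _ _ rfl ⟨fun q => ?_, fun w a b h0 hw => ?_⟩
      ⟨fun q => ?_, fun w a b h0 hw => ?_⟩
    · have := hcon (u + Polynomial.aeval v q, v) (Or.inr (Or.inr (Or.inl ⟨q, rfl⟩)))
      simpa using this
    · have := hcon (w, v) (Or.inl ⟨a, b, 1, by simpa using h0,
        by simpa using Dvd.intro_left _ hw, by simpa using hw, rfl⟩)
      simpa using this
    · have := hcon (u, v + Polynomial.aeval u q) (Or.inr (Or.inr (Or.inr (Or.inl ⟨q, rfl⟩))))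
      simpa using this
    · have := hcon (u, w) (Or.inr (Or.inl ⟨a, b, 1, by simpa using h0,
        by simpa using Dvd.intro_left _ hw, by simpa using hw, rfl⟩))
      simpa using this
  have hall : ∀ p, Relation.ReflTransGen ElemTrans (u, v) p →
      PeakRed.T (u.totalDegree + v.totalDegree) p.1 p.2 := by
    intro p hp
    induction hp with
    | refl => exact hT
    | tail _ h ih => exact PeakRed.et ih h
  have := (hall _ hseq).le
  simp only at this
  omega
end

section
/- Let K be a field of characteristic 0 and let (u,v) ∈ K[x,y]² determine a birational morphism of A² over K. Then the morphism x→u, y→v is a composition of K-algebra automorphisms of K[x,y] and copies of the map τ_x (x→x, y→xy) if and only if the pair (u,v) can be taken to the pair (x,y) by a finite sequence of elementary transformations (ET1), (ET1'), (ET2), (ET2'), (ET3). -/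
namespace SACProof

open Polynomial in
/-- Differentiation of the coefficients. -/
noncomputable def dz {K : Type*} [Field K] (p : K[X][X]) : K[X][X] :=
  p.sum fun k a => Polynomial.monomial k (Polynomial.derivative a)

section core
open Polynomial

variable {K : Type*} [Field K]

lemma coeff_dz (p : K[X][X]) (k : ℕ) : (dz p).coeff k = derivative (p.coeff k) := by
  unfold dz
  rw [Polynomial.sum_def, finsetSum_coeff]
  simp only [coeff_monomial]
  rw [Finset.sum_ite_eq']
  split_ifs with h
  · rfl
  · rw [notMem_support_iff.mp h]; simp

lemma dz_add (p q : K[X][X]) : dz (p + q) = dz p + dz q := by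
  ext1 k; simp [coeff_dz]

lemma dz_mul (p q : K[X][X]) : dz (p * q) = dz p * q + p * dz q := by
  ext1 k
  simp only [coeff_dz, coeff_mul, coeff_add, derivative_sum, derivative_mul, Finset.sum_add_distrib]

lemma dz_X : dz (X : K[X][X]) = 0 := by
  ext1 k; rw [coeff_dz, coeff_X]; split_ifs <;> simp

lemma dz_C (a : K[X]) : dz (C a) = C (derivative a) := by
  ext1 k; rw [coeff_dz, coeff_C, coeff_C]; split_ifs <;> simp

lemma natDegree_dz_le (p : K[X][X]) : (dz p).natDegree ≤ p.natDegree := by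
  rw [natDegree_le_iff_coeff_eq_zero]
  intro N hN
  rw [coeff_dz, coeff_eq_zero_of_natDegree_lt hN]; simp

/-- Jacobian bracket. -/
noncomputable def jac (F G : K[X][X]) : K[X][X] := derivative F * dz G - dz F * derivative G

lemma algMap_eq (r : K) : algebraMap K K[X][X] r = C (C r) := rfl

lemma chain_t (P : MvPolynomial (Fin 2) K) (F G : K[X][X]) :
    derivative (MvPolynomial.aeval ![F, G] P) =
      MvPolynomial.aeval ![F, G] (MvPolynomial.pderiv 0 P) * derivative F +
      MvPolynomial.aeval ![F, G] (MvPolynomial.pderiv 1 P) * derivative G := by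
  induction P using MvPolynomial.induction_on with
  | C a => simp
  | add p q hp hq => simp only [map_add, hp, hq]; ring
  | mul_X p i hp =>
    fin_cases i
    · simp [hp, MvPolynomial.pderiv_X, -MvPolynomial.pderiv_X_of_ne]; ring
    · simp [hp, MvPolynomial.pderiv_X]; ring

lemma chain_z (P : MvPolynomial (Fin 2) K) (F G : K[X][X]) :
    dz (MvPolynomial.aeval ![F, G] P) =
      MvPolynomial.aeval ![F, G] (MvPolynomial.pderiv 0 P) * dz F +
      MvPolynomial.aeval ![F, G] (MvPolynomial.pderiv 1 P) * dz G := by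
  induction P using MvPolynomial.induction_on with
  | C a => simp [dz_C]
  | add p q hp hq => simp only [map_add, dz_add, hp, hq]; ring
  | mul_X p i hp =>
    fin_cases i
    · simp [hp, MvPolynomial.pderiv_X, dz_mul]; ring
    · simp [hp, MvPolynomial.pderiv_X, dz_mul]; ring

lemma natDegree_jac (F H : K[X][X]) (hF : 1 ≤ F.natDegree) :
    (jac F H).natDegree + 1 ≤ F.natDegree + H.natDegree := by
  have h1 : (derivative F * dz H).natDegree ≤ F.natDegree + H.natDegree - 1 := by
    refine natDegree_mul_le.trans ?_
    have := natDegree_derivative_le F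
    have := natDegree_dz_le H
    omega
  have h2 : (dz F * derivative H).natDegree ≤ F.natDegree + H.natDegree - 1 := by
    rcases Nat.eq_zero_or_pos H.natDegree with h | h
    · rw [derivative_of_natDegree_zero h]; simp
    · refine natDegree_mul_le.trans ?_
      have := natDegree_derivative_le H
      have := natDegree_dz_le F
      omega
  have := natDegree_sub_le_of_le h1 h2
  unfold jac
  omega

/-- the operator `Y ∂_Y - l` -/
noncomputable def theta (l : ℕ) (P : MvPolynomial (Fin 2) K) : MvPolynomial (Fin 2) K :=
  MvPolynomial.X 1 * MvPolynomial.pderiv 1 P - MvPolynomial.C (l : K) * P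

lemma coeff_theta (l : ℕ) (P : MvPolynomial (Fin 2) K) (s : Fin 2 →₀ ℕ) :
    (theta l P).coeff s = ((s 1 : K) - l) * P.coeff s := by
  unfold theta
  rw [MvPolynomial.coeff_sub, MvPolynomial.coeff_C_mul, sub_mul]
  congr 1
  induction P using MvPolynomial.induction_on' with
  | monomial t a =>
    rw [MvPolynomial.X_mul_pderiv_monomial, MvPolynomial.coeff_smul, MvPolynomial.coeff_monomial]
    split_ifs with h
    · subst h; simp
    · simp
  | add p q hp hq => simp only [map_add, mul_add, MvPolynomial.coeff_add, hp, hq]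

lemma theta_deg (F G : K[X][X]) (hF : 1 ≤ F.natDegree) (hJ : jac F G ≠ 0) (l : ℕ)
    (P : MvPolynomial (Fin 2) K) :
    (MvPolynomial.aeval ![F, G] (theta l P)).natDegree ≤
      (MvPolynomial.aeval ![F, G] P).natDegree + (F.natDegree + G.natDegree - 1) := by
  set H := MvPolynomial.aeval ![F, G] P with hH
  have e : jac F H = MvPolynomial.aeval ![F, G] (MvPolynomial.pderiv 1 P) * jac F G := by
    unfold jac; rw [hH, chain_t, chain_z]; ring
  have hb := natDegree_jac F H hF
  have h1 : (MvPolynomial.aeval ![F, G] (MvPolynomial.pderiv 1 P)).natDegree + 1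
      ≤ F.natDegree + H.natDegree := by
    by_cases h0 : MvPolynomial.aeval ![F, G] (MvPolynomial.pderiv 1 P) = 0
    · rw [h0]; simp; omega
    · rw [e, natDegree_mul h0 hJ] at hb; omega
  unfold theta
  rw [map_sub, map_mul, map_mul, ← hH, MvPolynomial.aeval_X, MvPolynomial.aeval_C, algMap_eq]
  simp only [Matrix.cons_val_one, Matrix.cons_val_fin_one]
  refine (natDegree_sub_le_of_le natDegree_mul_le (natDegree_C_mul_le _ _)).trans ?_
  omega

lemma theta_iter (F G : K[X][X]) (hF : 1 ≤ F.natDegree) (hJ : jac F G ≠ 0)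
    (P : MvPolynomial (Fin 2) K) (S : Finset ℕ) :
    ∃ P' : MvPolynomial (Fin 2) K,
      (∀ s, P'.coeff s = (∏ l ∈ S, ((s 1 : K) - l)) * P.coeff s) ∧
      (MvPolynomial.aeval ![F, G] P').natDegree ≤
        (MvPolynomial.aeval ![F, G] P).natDegree + S.card * (F.natDegree + G.natDegree - 1) := by
  induction S using Finset.induction_on with
  | empty => exact ⟨P, by simp, by simp⟩
  | insert l S hl ih =>
    obtain ⟨P', h1, h2⟩ := ih
    refine ⟨theta l P', fun s => ?_, ?_⟩
    · rw [coeff_theta, h1, Finset.prod_insert hl]; ring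
    · have := theta_deg F G hF hJ l P'
      rw [Finset.card_insert_of_notMem hl, add_mul]
      omega

lemma le_natDegree_aeval (F G : K[X][X]) (hF0 : F ≠ 0) (hG0 : G ≠ 0)
    (P : MvPolynomial (Fin 2) K) (s₀ : Fin 2 →₀ ℕ)
    (h0 : P.coeff s₀ ≠ 0) (h : ∀ s, P.coeff s ≠ 0 → s ≠ s₀ →
      F.natDegree * s 0 + G.natDegree * s 1 < F.natDegree * s₀ 0 + G.natDegree * s₀ 1) :
    F.natDegree * s₀ 0 + G.natDegree * s₀ 1 ≤ (MvPolynomial.aeval ![F, G] P).natDegree := by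
  have hd : ∀ s : Fin 2 →₀ ℕ, (F ^ s 0 * G ^ s 1).natDegree =
      F.natDegree * s 0 + G.natDegree * s 1 := by
    intro s
    rw [natDegree_mul (pow_ne_zero _ hF0) (pow_ne_zero _ hG0), natDegree_pow, natDegree_pow]
    ring
  apply le_natDegree_of_ne_zero
  rw [MvPolynomial.aeval_def, MvPolynomial.eval₂_eq', finsetSum_coeff]
  rw [Finset.sum_eq_single s₀]
  · simp only [Fin.prod_univ_two, Matrix.cons_val_zero, Matrix.cons_val_one, algMap_eq,
      Matrix.cons_val_fin_one, coeff_C_mul]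
    rw [← hd s₀, coeff_natDegree]
    refine mul_ne_zero (by simpa using h0) ?_
    rw [leadingCoeff_ne_zero]
    exact mul_ne_zero (pow_ne_zero _ hF0) (pow_ne_zero _ hG0)
  · intro s hs hne
    simp only [Fin.prod_univ_two, Matrix.cons_val_zero, Matrix.cons_val_one, algMap_eq,
      Matrix.cons_val_fin_one, coeff_C_mul]
    rw [coeff_eq_zero_of_natDegree_lt, mul_zero]
    rw [hd]
    exact h s (MvPolynomial.mem_support_iff.mp hs) hne
  · intro hs
    exact absurd (MvPolynomial.mem_support_iff.mpr h0) hs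

lemma arith (p s d k j D : ℕ) (hd : 1 ≤ d) (hp : 2 ≤ p) (hs : 2 ≤ s) (hc : Nat.Coprime p s)
    (hk : 1 ≤ k) (hj : p * k ≤ j) (hD : s * d * j ≤ D)
    (h : D ≤ 1 + k * (p * d + s * d - 1)) : False := by
  have h1 : s * d * (p * k) ≤ 1 + k * (p * d + s * d - 1) :=
    (Nat.mul_le_mul_left _ hj).trans (hD.trans h)
  have hne : p ≠ s := by
    rintro rfl
    rw [Nat.coprime_self] at hc; omega
  have h2 : p + s + 1 ≤ p * s := by
    rcases lt_or_gt_of_ne hne with h | h <;> nlinarith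
  have h3 : p * d + s * d + 1 ≤ s * d * p := by nlinarith
  have h4 : k * (p * d + s * d + 1) ≤ k * (s * d * p) := Nat.mul_le_mul_left _ h3
  have h5 : k * (p * d + s * d - 1) + 2 * k = k * (p * d + s * d + 1) := by
    have : p * d + s * d + 1 = (p * d + s * d - 1) + 2 := by
      have : 1 ≤ p * d := Nat.mul_pos (by omega) hd
      omega
    rw [this]; ring
  have h6 : s * d * (p * k) = k * (s * d * p) := by ring
  omega

lemma small_weights (n m x y : ℕ) (hn : 2 ≤ n) (hm : 2 ≤ m) (h : n * x + m * y ≤ 1) :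
    x = 0 ∧ y = 0 := by
  have h1 : 2 * x ≤ n * x := Nat.mul_le_mul_right _ hn
  have h2 : 2 * y ≤ m * y := Nat.mul_le_mul_right _ hm
  omega

set_option maxHeartbeats 1000000 in
/-- Degrees of a Jacobian pair that generates an element of degree one divide each other. -/
lemma dvd_or_dvd [CharZero K] (F G : K[X][X]) (hF : 1 ≤ F.natDegree) (hG : 1 ≤ G.natDegree)
    (hJ : jac F G ≠ 0) (P : MvPolynomial (Fin 2) K)
    (hP : (MvPolynomial.aeval ![F, G] P).natDegree = 1) :
    F.natDegree ∣ G.natDegree ∨ G.natDegree ∣ F.natDegree := by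
  by_contra hcon
  push Not at hcon
  have hF0 : F ≠ 0 := by rintro rfl; simp at hF
  have hG0 : G ≠ 0 := by rintro rfl; simp at hG
  obtain ⟨d, p, s, hd, hcop, hn, hm⟩ : ∃ d p s, 0 < d ∧ Nat.Coprime p s ∧
      F.natDegree = p * d ∧ G.natDegree = s * d := by
    obtain ⟨p, s, h1, h2, h3⟩ := Nat.exists_coprime F.natDegree G.natDegree
    exact ⟨_, p, s, Nat.gcd_pos_of_pos_left _ hF, h1, h2, h3⟩
  have hp : 2 ≤ p := by
    by_contra h
    interval_cases p
    · omega
    · apply hcon.1; rw [hn, hm]; simp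
  have hs : 2 ≤ s := by
    by_contra h
    interval_cases s
    · omega
    · apply hcon.2; rw [hn, hm]; simp
  let w : (Fin 2 →₀ ℕ) → ℕ := fun t => F.natDegree * t 0 + G.natDegree * t 1
  have hne : P.support.Nonempty := by
    rw [Finset.nonempty_iff_ne_empty, Ne, MvPolynomial.support_eq_empty]
    rintro rfl; simp at hP
  obtain ⟨sm, hsm, hmax⟩ := Finset.exists_max_image P.support w hne
  set D := w sm with hDdef
  -- the top weight part
  let T0 := P.support.filter (fun t => w t = D)
  have hT0 : T0.Nonempty := ⟨sm, by simp only [T0, Finset.mem_filter]; exact ⟨hsm, rfl⟩⟩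
  obtain ⟨s₀, hs₀, hs₀max⟩ := Finset.exists_max_image T0 (fun t => t 1) hT0
  simp only [T0, Finset.mem_filter] at hs₀
  let T := T0.image (fun t => t 1)
  have hmod : ∀ t ∈ T0, t 1 ≡ s₀ 1 [MOD p] := by
    intro t ht
    simp only [T0, Finset.mem_filter] at ht
    have he : F.natDegree * t 0 + G.natDegree * t 1 = F.natDegree * s₀ 0 + G.natDegree * s₀ 1 :=
      ht.2.trans hs₀.2.symm
    rw [hn, hm] at he
    have he2 : p * t 0 + s * t 1 = p * s₀ 0 + s * s₀ 1 := by
      apply Nat.eq_of_mul_eq_mul_right hd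
      linarith
    have he3 : s * t 1 ≡ s * s₀ 1 [MOD p] := by
      have : p * t 0 + s * t 1 ≡ p * s₀ 0 + s * s₀ 1 [MOD p] := by rw [he2]
      have h1 : p * t 0 ≡ 0 [MOD p] := (Nat.modEq_zero_iff_dvd).mpr (dvd_mul_right _ _)
      have h2 : p * s₀ 0 ≡ 0 [MOD p] := (Nat.modEq_zero_iff_dvd).mpr (dvd_mul_right _ _)
      exact Nat.ModEq.add_left_cancel (h1.trans h2.symm) this
    exact Nat.ModEq.cancel_left_of_coprime hcop he3
  have hTcard : T.card ≤ s₀ 1 / p + 1 := by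
    rw [← Finset.card_range (s₀ 1 / p + 1)]
    apply Finset.card_le_card_of_injOn (fun j => j / p)
    · intro j hj
      simp only [T, Finset.coe_image, Set.mem_image, Finset.mem_coe] at hj
      obtain ⟨t, ht, rfl⟩ := hj
      simp only [Finset.coe_range, Set.mem_Iio]
      exact Nat.lt_succ_of_le (Nat.div_le_div_right (hs₀max t ht))
    · intro j hj j' hj' hjj
      simp only [T, Finset.coe_image, Set.mem_image, Finset.mem_coe] at hj hj'
      obtain ⟨t, ht, rfl⟩ := hj
      obtain ⟨t', ht', rfl⟩ := hj'
      have h1 : t 1 % p = t' 1 % p := (hmod t ht).trans (hmod t' ht').symm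
      simp only at hjj
      rw [← Nat.div_add_mod (t 1) p, ← Nat.div_add_mod (t' 1) p, hjj, h1]
  have hs₀T : s₀ 1 ∈ T := Finset.mem_image.mpr ⟨s₀, by simp [T0, hs₀.2, MvPolynomial.mem_support_iff.mp hs₀.1], rfl⟩
  obtain ⟨P', hc', hd'⟩ := theta_iter F G hF hJ P (T.erase (s₀ 1))
  have hlow : F.natDegree * s₀ 0 + G.natDegree * s₀ 1 ≤ (MvPolynomial.aeval ![F, G] P').natDegree := by
    apply le_natDegree_aeval F G hF0 hG0
    · rw [hc']
      refine mul_ne_zero ?_ (MvPolynomial.mem_support_iff.mp hs₀.1)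
      rw [Finset.prod_ne_zero_iff]
      intro l hl
      rw [sub_ne_zero]
      exact_mod_cast (Finset.ne_of_mem_erase hl).symm
    · intro t ht htne
      rw [hc'] at ht
      have hts : t ∈ P.support := MvPolynomial.mem_support_iff.mpr (right_ne_zero_of_mul ht)
      have hle : w t ≤ D := hmax t hts
      have hw0 : F.natDegree * s₀ 0 + G.natDegree * s₀ 1 = D := hs₀.2
      rw [hw0]
      refine lt_of_le_of_ne hle ?_
      intro heq
      have htT0 : t ∈ T0 := by simp only [T0, Finset.mem_filter]; exact ⟨hts, heq⟩
      by_cases h1 : t 1 = s₀ 1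
      · apply htne
        have h3 : F.natDegree * t 0 + G.natDegree * t 1 = D := heq
        rw [h1, ← hw0] at h3
        have h4 : t 0 = s₀ 0 := Nat.eq_of_mul_eq_mul_left hF (Nat.add_right_cancel h3)
        ext i; fin_cases i
        · exact h4
        · exact h1
      · apply left_ne_zero_of_mul ht
        apply Finset.prod_eq_zero (i := t 1)
        · exact Finset.mem_erase.mpr ⟨h1, Finset.mem_image.mpr ⟨t, htT0, rfl⟩⟩
        · simp
  have hw0 : F.natDegree * s₀ 0 + G.natDegree * s₀ 1 = D := hs₀.2
  rw [hP] at hd'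
  set k := (T.erase (s₀ 1)).card with hk
  have hkT : k + 1 = T.card := Finset.card_erase_add_one hs₀T
  have hkle : k ≤ s₀ 1 / p := by omega
  have hpk : p * k ≤ s₀ 1 := (Nat.mul_le_mul_left p hkle).trans (Nat.mul_div_le _ _)
  have hDge : s * d * s₀ 1 ≤ D := by rw [← hw0, hm]; omega
  have hDle : D ≤ 1 + k * (p * d + s * d - 1) := by rw [← hn, ← hm]; omega
  rcases Nat.eq_zero_or_pos k with h0 | hkpos
  · rw [h0] at hDle
    -- all monomials have weight at most one
    have hall : ∀ t ∈ P.support, t = 0 := by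
      intro t ht
      have h1 : F.natDegree * t 0 + G.natDegree * t 1 ≤ D := hmax t ht
      have hn2 : 2 ≤ F.natDegree := by rw [hn]; exact hp.trans (Nat.le_mul_of_pos_right _ hd)
      have hm2 : 2 ≤ G.natDegree := by rw [hm]; exact hs.trans (Nat.le_mul_of_pos_right _ hd)
      have h2 := small_weights _ _ _ _ hn2 hm2 (h1.trans (by omega))
      ext i; fin_cases i
      · exact h2.1
      · exact h2.2
    have hPC : P = MvPolynomial.C (P.coeff 0) := by
      ext t
      rw [MvPolynomial.coeff_C]
      split_ifs with h
      · rw [← h]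
      · by_contra h2
        exact h (hall t (MvPolynomial.mem_support_iff.mpr h2)).symm
    rw [hPC, MvPolynomial.aeval_C, algMap_eq, natDegree_C] at hP
    omega
  · exact arith p s d k (s₀ 1) D hd hp hs hcop hkpos hpk hDge hDle

lemma wronskian_prop [CharZero K] (A B : K[X]) (hA : A ≠ 0)
    (h : A * derivative B = derivative A * B) : ∃ c : K, B = C c * A := by
  classical
  have hcop := isCoprime_div_gcd_div_gcd (p := B) hA
  set g := GCDMonoid.gcd B A with hg
  have hg0 : g ≠ 0 := by
    intro h0; rw [hg, gcd_eq_zero_iff] at h0; exact hA h0.2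
  obtain ⟨B', hB'⟩ := GCDMonoid.gcd_dvd_left B A
  obtain ⟨A', hA'⟩ := GCDMonoid.gcd_dvd_right B A
  rw [← hg] at hA' hB'
  have e1 : B / g = B' := by rw [hB', mul_div_cancel_left₀ _ hg0]
  have e2 : A / g = A' := by rw [hA', mul_div_cancel_left₀ _ hg0]
  rw [e1, e2] at hcop
  have hw : wronskian B' A' = 0 := by
    have : g ^ 2 * wronskian B' A' = 0 := by
      rw [hA', hB'] at h
      simp only [derivative_mul] at h
      unfold wronskian
      linear_combination -h
    exact (mul_eq_zero.mp this).resolve_left (pow_ne_zero _ hg0)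
  obtain ⟨h1, h2⟩ := hcop.wronskian_eq_zero_iff.mp hw
  have hb := eq_C_of_derivative_eq_zero h1
  have ha := eq_C_of_derivative_eq_zero h2
  have ha0 : A'.coeff 0 ≠ 0 := by
    intro h0; apply hA; rw [hA', ha, h0]; simp
  refine ⟨B'.coeff 0 / A'.coeff 0, ?_⟩
  rw [hA', hB', ha, hb]
  simp only [coeff_C_zero]
  rw [mul_left_comm, ← C_mul, div_mul_cancel₀ _ ha0]

lemma exists_reduce [CharZero K] (F G : K[X][X]) (hF : 1 ≤ F.natDegree)
    (h2 : 2 < F.natDegree + G.natDegree) (hJ : (jac F G).natDegree ≤ 1)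
    (k : ℕ) (hk : 1 ≤ k) (hm : G.natDegree = F.natDegree * k) :
    ∃ c : K, (G - C (C c) * F ^ k).natDegree < G.natDegree := by
  set n := F.natDegree with hn
  set m := G.natDegree with hmm
  set a := F.leadingCoeff with ha
  set b := G.leadingCoeff with hb
  have hF0 : F ≠ 0 := by rintro rfl; simp [hn] at hF
  have ha0 : a ≠ 0 := leadingCoeff_ne_zero.mpr hF0
  have hmpos : 1 ≤ m := by rw [hm]; exact Nat.mul_pos hF hk
  have hz : (jac F G).coeff (n - 1 + m) = 0 := coeff_eq_zero_of_natDegree_lt (by omega)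
  have c1 : (derivative F * dz G).coeff (n - 1 + m) = (n : K[X]) * a * derivative b := by
    rw [coeff_mul_add_eq_of_natDegree_le (natDegree_derivative_le F) (natDegree_dz_le G),
      coeff_derivative, coeff_dz]
    have : n - 1 + 1 = n := by omega
    rw [← hn, ← hmm, this, hn, hmm, coeff_natDegree, coeff_natDegree, ← hn, ← ha, ← hb]
    have : ((n - 1 : ℕ) : K[X]) + 1 = n := by exact_mod_cast this
    rw [this]; ring
  have c2 : (dz F * derivative G).coeff (n - 1 + m) = (m : K[X]) * b * derivative a := by
    have e : n - 1 + m = n + (m - 1) := by omega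
    rw [e, coeff_mul_add_eq_of_natDegree_le (natDegree_dz_le F) (natDegree_derivative_le G),
      coeff_derivative, coeff_dz]
    have : m - 1 + 1 = m := by omega
    rw [← hn, ← hmm, this, hn, hmm, coeff_natDegree, coeff_natDegree, ← hmm, ← ha, ← hb]
    have : ((m - 1 : ℕ) : K[X]) + 1 = m := by exact_mod_cast this
    rw [this]; ring
  rw [jac, coeff_sub, c1, c2, hm] at hz
  have hn0 : (n : K[X]) ≠ 0 := by exact_mod_cast (by omega : n ≠ 0)
  have key : a * derivative b = k * b * derivative a := by
    apply mul_left_cancel₀ hn0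
    push_cast at hz
    linear_combination hz
  obtain ⟨c, hc⟩ := wronskian_prop (a ^ k) b (pow_ne_zero _ ha0) (by
    obtain ⟨j, rfl⟩ : ∃ j, k = j + 1 := ⟨k - 1, by omega⟩
    rw [derivative_pow]
    simp only [Nat.add_sub_cancel, map_natCast]
    rw [pow_succ]
    linear_combination a ^ j * key)
  refine ⟨c, ?_⟩
  have hle : (G - C (C c) * F ^ k).natDegree ≤ m := by
    refine (natDegree_sub_le_of_le le_rfl ((natDegree_C_mul_le _ _).trans (natDegree_pow_le))).trans ?_
    rw [← hn, ← hmm, hm, mul_comm k n, max_self]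
  refine lt_of_le_of_ne hle ?_
  intro he
  have h0 : (G - C (C c) * F ^ k).coeff m = 0 := by
    rw [coeff_sub, coeff_C_mul, hmm, coeff_natDegree, ← hmm, hm, mul_comm n k]
    rw [coeff_pow_mul_natDegree, ← hb, ← ha, hc, sub_self]
  have h1 : (G - C (C c) * F ^ k).leadingCoeff = 0 := by
    rw [leadingCoeff, he]; exact h0
  rw [leadingCoeff_eq_zero] at h1
  rw [h1] at he; simp at he; omega

end core

section iota
open Polynomial

variable {K : Type*} [Field K]

/-- `x ↦ t`, `y ↦ t z`. -/
noncomputable def iota (K : Type*) [Field K] : MvPolynomial (Fin 2) K →ₐ[K] K[X][X] :=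
  MvPolynomial.aeval ![X, X * C X]

lemma iota_monomial (s : Fin 2 →₀ ℕ) (a : K) :
    iota K (MvPolynomial.monomial s a) = monomial (s 0 + s 1) (monomial (s 1) a) := by
  rw [iota, MvPolynomial.aeval_monomial, Finsupp.prod_fintype _ _ (by simp)]
  simp only [Fin.prod_univ_two, Matrix.cons_val_zero, Matrix.cons_val_one,
    Matrix.cons_val_fin_one, algMap_eq]
  rw [← C_mul_X_pow_eq_monomial, ← C_mul_X_pow_eq_monomial, mul_pow, pow_add, C_mul, C_pow]
  ring

lemma coeff_iota (u : MvPolynomial (Fin 2) K) (s : Fin 2 →₀ ℕ) :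
    ((iota K u).coeff (s 0 + s 1)).coeff (s 1) = u.coeff s := by
  induction u using MvPolynomial.induction_on' with
  | monomial t a =>
    rw [iota_monomial, coeff_monomial, MvPolynomial.coeff_monomial]
    by_cases h : t = s
    · subst h; simp
    · rw [if_neg h]
      split_ifs with h1
      · rw [coeff_monomial, if_neg]
        intro h2
        apply h
        ext i; fin_cases i
        · show t 0 = s 0
          omega
        · exact h2
      · simp
  | add p q hp hq => simp only [map_add, coeff_add, MvPolynomial.coeff_add, hp, hq]

lemma coeff_eq_zero_of_lt (u : MvPolynomial (Fin 2) K) (s : Fin 2 →₀ ℕ)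
    (h : (iota K u).natDegree < s 0 + s 1) : u.coeff s = 0 := by
  rw [← coeff_iota, coeff_eq_zero_of_natDegree_lt h, coeff_zero]

lemma eq_linear (u : MvPolynomial (Fin 2) K) (h : (iota K u).natDegree ≤ 1) :
    ∃ e a b : K, u = MvPolynomial.C e + MvPolynomial.C a * MvPolynomial.X 0 +
      MvPolynomial.C b * MvPolynomial.X 1 := by
  refine ⟨u.coeff 0, u.coeff (Finsupp.single 0 1), u.coeff (Finsupp.single 1 1), ?_⟩
  ext s
  simp only [MvPolynomial.coeff_add, MvPolynomial.coeff_C_mul, MvPolynomial.coeff_C,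
    MvPolynomial.coeff_X]
  have hs : ∀ t : Fin 2 →₀ ℕ, t = s ↔ t 0 = s 0 ∧ t 1 = s 1 := by
    intro t
    constructor
    · rintro rfl; simp
    · rintro ⟨h0, h1⟩; ext i; fin_cases i <;> assumption
  simp only [hs]
  by_cases h2 : 1 < s 0 + s 1
  · rw [coeff_eq_zero_of_lt u s (by omega)]
    have a1 : ¬ ((0 : Fin 2 →₀ ℕ) 0 = s 0 ∧ (0 : Fin 2 →₀ ℕ) 1 = s 1) := by simp; omega
    have a2 : ¬ ((Finsupp.single 0 1 : Fin 2 →₀ ℕ) 0 = s 0 ∧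
      (Finsupp.single 0 1 : Fin 2 →₀ ℕ) 1 = s 1) := by simp; omega
    have a3 : ¬ ((Finsupp.single 1 1 : Fin 2 →₀ ℕ) 0 = s 0 ∧
      (Finsupp.single 1 1 : Fin 2 →₀ ℕ) 1 = s 1) := by simp; omega
    rw [if_neg a1, if_neg a2, if_neg a3]; simp
  · have hc : (0 = s 0 ∧ 0 = s 1) ∨ (1 = s 0 ∧ 0 = s 1) ∨ (0 = s 0 ∧ 1 = s 1) := by omega
    rcases hc with hc | hc | hc
    · have : (0 : Fin 2 →₀ ℕ) = s := (hs _).mpr (by simpa using hc)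
      subst this; simp
    · have : (Finsupp.single 0 1 : Fin 2 →₀ ℕ) = s := (hs _).mpr (by simpa using hc)
      subst this; simp
    · have : (Finsupp.single 1 1 : Fin 2 →₀ ℕ) = s := (hs _).mpr (by simpa using hc)
      subst this; simp

lemma eq_const (u : MvPolynomial (Fin 2) K) (h : (iota K u).natDegree = 0) :
    u = MvPolynomial.C (u.coeff 0) := by
  ext s
  rw [MvPolynomial.coeff_C]
  split_ifs with h1
  · rw [← h1]
  · apply coeff_eq_zero_of_lt
    rw [h]
    by_contra h2
    apply h1
    ext i; fin_cases i
    · show 0 = s 0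
      omega
    · show 0 = s 1
      omega

/-- `u, v` generate the polynomial ring. -/
def Gen (u v : MvPolynomial (Fin 2) K) : Prop :=
  ∃ P Q : MvPolynomial (Fin 2) K, MvPolynomial.aeval ![u, v] P = MvPolynomial.X 0 ∧
    MvPolynomial.aeval ![u, v] Q = MvPolynomial.X 1

lemma aeval_aeval {A : Type*} [CommRing A] [Algebra K A] (u v : A)
    (f g P : MvPolynomial (Fin 2) K) :
    MvPolynomial.aeval ![u, v] (MvPolynomial.aeval ![f, g] P) =
      MvPolynomial.aeval ![MvPolynomial.aeval ![u, v] f, MvPolynomial.aeval ![u, v] g] P := by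
  rw [← AlgHom.comp_apply, MvPolynomial.comp_aeval]
  congr 2
  ext i; fin_cases i <;> rfl

lemma hom_aeval {A B : Type*} [CommRing A] [Algebra K A] [CommRing B] [Algebra K B]
    (θ : A →ₐ[K] B) (u v : A) (P : MvPolynomial (Fin 2) K) :
    θ (MvPolynomial.aeval ![u, v] P) = MvPolynomial.aeval ![θ u, θ v] P := by
  rw [← AlgHom.comp_apply, MvPolynomial.comp_aeval]
  congr 2
  ext i; fin_cases i <;> rfl

lemma Gen.swap {u v : MvPolynomial (Fin 2) K} (h : Gen u v) : Gen v u := by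
  obtain ⟨P, Q, hP, hQ⟩ := h
  refine ⟨MvPolynomial.aeval ![MvPolynomial.X 1, MvPolynomial.X 0] P,
    MvPolynomial.aeval ![MvPolynomial.X 1, MvPolynomial.X 0] Q, ?_, ?_⟩ <;>
  · rw [aeval_aeval]; simpa

lemma Gen.sub {u v : MvPolynomial (Fin 2) K} (h : Gen u v) (c : K) (k : ℕ) :
    Gen u (v - MvPolynomial.C c * u ^ k) := by
  obtain ⟨P, Q, hP, hQ⟩ := h
  refine ⟨MvPolynomial.aeval ![MvPolynomial.X 0, MvPolynomial.X 1 + MvPolynomial.C c * MvPolynomial.X 0 ^ k] P,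
    MvPolynomial.aeval ![MvPolynomial.X 0, MvPolynomial.X 1 + MvPolynomial.C c * MvPolynomial.X 0 ^ k] Q, ?_, ?_⟩ <;>
  · rw [aeval_aeval]
    simp [← MvPolynomial.algebraMap_eq]
    simpa

lemma jac_gen {u v : MvPolynomial (Fin 2) K} (h : Gen u v) :
    jac (iota K u) (iota K v) ≠ 0 ∧ (jac (iota K u) (iota K v)).natDegree ≤ 1 ∧
    ∃ P : MvPolynomial (Fin 2) K,
      (MvPolynomial.aeval ![iota K u, iota K v] P).natDegree = 1 := by
  obtain ⟨P, Q, hP, hQ⟩ := h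
  have hP' : MvPolynomial.aeval ![iota K u, iota K v] P = X := by
    rw [← hom_aeval, hP]; simp [iota]
  have hQ' : MvPolynomial.aeval ![iota K u, iota K v] Q = X * C X := by
    rw [← hom_aeval, hQ]; simp [iota]
  have e1 : jac (X : K[X][X]) (X * C X) = X := by
    simp [jac, dz_mul, dz_X, dz_C]
  have e2 : (X : K[X][X]) =
      (MvPolynomial.aeval ![iota K u, iota K v] (MvPolynomial.pderiv 0 P) *
       MvPolynomial.aeval ![iota K u, iota K v] (MvPolynomial.pderiv 1 Q) -
       MvPolynomial.aeval ![iota K u, iota K v] (MvPolynomial.pderiv 1 P) *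
       MvPolynomial.aeval ![iota K u, iota K v] (MvPolynomial.pderiv 0 Q)) *
      jac (iota K u) (iota K v) := by
    conv_lhs => rw [← e1, ← hP']
    have : (MvPolynomial.aeval ![iota K u, iota K v]) P * C X =
      MvPolynomial.aeval ![iota K u, iota K v] Q := by rw [hQ', hP']
    rw [this]
    unfold jac
    rw [chain_t, chain_t, chain_z, chain_z]
    ring
  have hX : (X : K[X][X]) ≠ 0 := X_ne_zero
  refine ⟨?_, ?_, P, ?_⟩
  · intro h0; rw [h0, mul_zero] at e2; exact hX e2
  · have hh := e2 ▸ hX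
    have := congrArg natDegree e2
    rw [natDegree_X, natDegree_mul (left_ne_zero_of_mul hh) (right_ne_zero_of_mul hh)] at this
    omega
  · rw [hP']; simp

lemma Gen.natDegree_pos {u v : MvPolynomial (Fin 2) K} (h : Gen u v) :
    1 ≤ (iota K u).natDegree := by
  by_contra h0
  have hu := eq_const u (by omega)
  apply (jac_gen h).1
  rw [hu]
  unfold jac
  simp [← MvPolynomial.algebraMap_eq, algMap_eq, dz_C]

end iota

section jung

variable {K : Type*} [Field K]


lemma step_swap (u v : MvPolynomial (Fin 2) K) : ElemTrans (u, v) (v, u) := by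
  right; right; right; right; rfl

lemma step_sub (u v : MvPolynomial (Fin 2) K) (c : K) (k : ℕ) :
    ElemTrans (u, v) (u, v - MvPolynomial.C c * u ^ k) := by
  right; right; right; left
  refine ⟨Polynomial.C (-c) * Polynomial.X ^ k, ?_⟩
  simp [← MvPolynomial.algebraMap_eq, sub_eq_add_neg]

lemma step_scale (u v : MvPolynomial (Fin 2) K) (c : K) (hc : c ≠ 0) :
    ElemTrans (u, MvPolynomial.C c * v) (u, v) := by
  right; left
  refine ⟨0, c, 0, ?_, ?_, ?_, rfl⟩
  · simpa using hc
  · simp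
  · simp [mul_comm]

lemma jung_linear (e a b e' a' b' : K) (h : a * b' - b * a' ≠ 0) (ha : a ≠ 0) :
    Relation.ReflTransGen (ElemTrans (K := K)) (MvPolynomial.C e + MvPolynomial.C a * MvPolynomial.X 0 + MvPolynomial.C b * MvPolynomial.X 1,
      MvPolynomial.C e' + MvPolynomial.C a' * MvPolynomial.X 0 + MvPolynomial.C b' * MvPolynomial.X 1)
      (MvPolynomial.X 0, MvPolynomial.X 1) := by
  set u : MvPolynomial (Fin 2) K :=
    MvPolynomial.C e + MvPolynomial.C a * MvPolynomial.X 0 + MvPolynomial.C b * MvPolynomial.X 1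
  set d := (a * b' - b * a') / a with hd
  have hd0 : d ≠ 0 := div_ne_zero h ha
  refine .head (step_sub _ _ (a' / a) 1) ?_
  refine .head (step_sub _ _ (e' - (a' / a) * e) 0) ?_
  have e1 : MvPolynomial.C e' + MvPolynomial.C a' * MvPolynomial.X 0 + MvPolynomial.C b' * MvPolynomial.X 1
      - MvPolynomial.C (a' / a) * u ^ 1 - MvPolynomial.C (e' - (a' / a) * e) * u ^ 0 =
      MvPolynomial.C d * MvPolynomial.X 1 := by
    have h1 : a' = (a' / a) * a := by field_simp
    have h2 : d = b' - (a' / a) * b := by rw [hd]; field_simp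
    have h1' : (MvPolynomial.C a' : MvPolynomial (Fin 2) K) =
      MvPolynomial.C (a' / a) * MvPolynomial.C a := by rw [← MvPolynomial.C_mul, ← h1]
    rw [h2, h1']
    simp only [u, map_sub, map_mul]
    ring
  rw [e1]
  refine .head (step_scale _ _ d hd0) ?_
  refine .head (step_swap _ _) ?_
  refine .head (step_sub _ _ b 1) ?_
  refine .head (step_sub _ _ e 0) ?_
  have e2 : u - MvPolynomial.C b * MvPolynomial.X 1 ^ 1 - MvPolynomial.C e * MvPolynomial.X 1 ^ 0 =
      MvPolynomial.C a * MvPolynomial.X 0 := by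
    simp only [u]; ring
  rw [e2]
  refine .head (step_scale _ _ a ha) ?_
  exact .single (step_swap _ _)

open Polynomial in
lemma det_ne_zero {e a b e' a' b' : K}
    (h : jac (iota K (MvPolynomial.C e + MvPolynomial.C a * MvPolynomial.X 0 + MvPolynomial.C b * MvPolynomial.X 1))
      (iota K (MvPolynomial.C e' + MvPolynomial.C a' * MvPolynomial.X 0 + MvPolynomial.C b' * MvPolynomial.X 1)) ≠ 0) :
    a * b' - b * a' ≠ 0 := by
  intro h0
  apply h
  have hh : ∀ e a b : K, iota K (MvPolynomial.C e + MvPolynomial.C a * MvPolynomial.X 0 + MvPolynomial.C b * MvPolynomial.X 1)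
      = C (C e) + C (C a) * X + C (C b) * (X * C X) := by
    intro e a b
    simp [iota, algMap_eq, ← MvPolynomial.algebraMap_eq]
  have h1 : (C (C a) * C (C b') - C (C b) * C (C a') : K[X][X]) = 0 := by
    rw [← C_mul, ← C_mul, ← C_mul, ← C_mul, ← C_sub, ← C_sub, h0]; simp
  rw [hh, hh]
  simp [jac, dz_add, dz_mul, dz_C, dz_X]
  linear_combination (X : K[X][X]) * h1

theorem jung [CharZero K] (N : ℕ) : ∀ u v : MvPolynomial (Fin 2) K, Gen u v →
    (iota K u).natDegree + (iota K v).natDegree ≤ N →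
    Relation.ReflTransGen (ElemTrans (K := K)) (u, v) (MvPolynomial.X 0, MvPolynomial.X 1) := by
  induction N with
  | zero =>
    intro u v h hN
    have := h.natDegree_pos
    omega
  | succ N ih =>
    intro u v h hN
    have hu := h.natDegree_pos
    have hv := h.swap.natDegree_pos
    have red : ∀ u v : MvPolynomial (Fin 2) K, Gen u v →
        (iota K u).natDegree + (iota K v).natDegree ≤ N + 1 →
        2 < (iota K u).natDegree + (iota K v).natDegree →
        (iota K u).natDegree ∣ (iota K v).natDegree →
        Relation.ReflTransGen (ElemTrans (K := K)) (u, v) (MvPolynomial.X 0, MvPolynomial.X 1) := by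
      rintro u v h hN h2 ⟨k, hk⟩
      have hv := h.swap.natDegree_pos
      obtain ⟨c, hc⟩ := exists_reduce _ _ h.natDegree_pos h2 (jac_gen h).2.1 k
        (by rcases Nat.eq_zero_or_pos k with h0 | h0
            · rw [h0] at hk; omega
            · exact h0) hk
      refine .head (step_sub u v c k) (ih _ _ (h.sub c k) ?_)
      have : iota K (v - MvPolynomial.C c * u ^ k) =
          iota K v - Polynomial.C (Polynomial.C c) * iota K u ^ k := by
        simp [← MvPolynomial.algebraMap_eq, algMap_eq]
      rw [this]
      omega
    by_cases h2 : 2 < (iota K u).natDegree + (iota K v).natDegree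
    · obtain ⟨hJ, -, P, hP⟩ := jac_gen h
      rcases dvd_or_dvd _ _ hu hv hJ P hP with hd | hd
      · exact red u v h hN h2 hd
      · exact .head (step_swap u v) (red v u h.swap (by omega) (by omega) hd)
    · obtain ⟨e, a, b, rfl⟩ := eq_linear u (by omega)
      obtain ⟨e', a', b', rfl⟩ := eq_linear v (by omega)
      have hdet := det_ne_zero (jac_gen h).1
      by_cases ha : a = 0
      · refine .head (step_swap _ _) (jung_linear _ _ _ _ _ _ ?_ ?_)
        · intro h0; apply hdet; linear_combination -h0
        · rintro rfl; apply hdet; rw [ha]; ring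
      · exact jung_linear _ _ _ _ _ _ hdet ha

/-- Elementary transformations are compatible with injective substitutions. -/
lemma ElemTrans_map (θ : MvPolynomial (Fin 2) K →ₐ[K] MvPolynomial (Fin 2) K)
    (hθ : Function.Injective θ) (p p' : MvPolynomial (Fin 2) K × MvPolynomial (Fin 2) K)
    (h : ElemTrans p p') : ElemTrans (θ p.1, θ p.2) (θ p'.1, θ p'.2) := by
  have hC : ∀ c : K, θ (MvPolynomial.C c) = MvPolynomial.C c := fun c => θ.commutes c
  rcases h with ⟨a, b, c, h1, h2, h3, h4⟩ | ⟨a, b, c, h1, h2, h3, h4⟩ | ⟨q, rfl⟩ | ⟨q, rfl⟩ | rfl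
  · left
    have e : MvPolynomial.C c * θ p.2 + MvPolynomial.C b =
      θ (MvPolynomial.C c * p.2 + MvPolynomial.C b) := by simp [hC]
    have e' : θ p.1 + MvPolynomial.C a = θ (p.1 + MvPolynomial.C a) := by simp [hC]
    refine ⟨a, b, c, ?_, ?_, ?_, ?_⟩
    · simp only [e]
      exact (map_ne_zero_iff θ hθ).mpr h1
    · simp only [e, e']
      exact map_dvd θ h2
    · simp only [e, e', ← h3, map_mul]
    · simp only [h4]
  · right; left
    have e : MvPolynomial.C c * θ p.1 + MvPolynomial.C b =
      θ (MvPolynomial.C c * p.1 + MvPolynomial.C b) := by simp [hC]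
    have e' : θ p.2 + MvPolynomial.C a = θ (p.2 + MvPolynomial.C a) := by simp [hC]
    refine ⟨a, b, c, ?_, ?_, ?_, ?_⟩
    · simp only [e]
      exact (map_ne_zero_iff θ hθ).mpr h1
    · simp only [e, e']
      exact map_dvd θ h2
    · simp only [e, e', ← h3, map_mul]
    · simp only [h4]
  · right; right; left
    exact ⟨q, by simp [Polynomial.aeval_algHom_apply]⟩
  · right; right; right; left
    exact ⟨q, by simp [Polynomial.aeval_algHom_apply]⟩
  · right; right; right; right; rfl

lemma tauX_injective : Function.Injective (tauX K) := by
  have hX : (MvPolynomial.X 0 : MvPolynomial (Fin 2) K) ≠ 0 := MvPolynomial.X_ne_zero 0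
  have hmon : ∀ (s : Fin 2 →₀ ℕ) (a : K), tauX K (MvPolynomial.monomial s a) =
      MvPolynomial.monomial (s + Finsupp.single 0 (s 1)) a := by
    intro s a
    rw [tauX, MvPolynomial.aeval_monomial, Finsupp.prod_fintype _ _ (by simp),
      MvPolynomial.monomial_eq, Finsupp.prod_fintype _ _ (by simp)]
    simp [Fin.prod_univ_two, MvPolynomial.algebraMap_eq]
    left; ring
  have hco : ∀ (p : MvPolynomial (Fin 2) K) (s : Fin 2 →₀ ℕ),
      (tauX K p).coeff (s + Finsupp.single 0 (s 1)) = p.coeff s := by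
    intro p s
    induction p using MvPolynomial.induction_on' with
    | monomial t a =>
      rw [hmon, MvPolynomial.coeff_monomial, MvPolynomial.coeff_monomial]
      congr 1
      apply propext
      constructor
      · intro h
        have h1 := DFunLike.congr_fun h 1
        have h0 := DFunLike.congr_fun h 0
        simp at h1 h0
        ext i; fin_cases i
        · show t 0 = s 0
          omega
        · exact h1
      · rintro rfl; rfl
    | add p q hp hq => simp only [map_add, MvPolynomial.coeff_add, hp, hq]
  intro p q hpq
  ext s
  rw [← hco p, ← hco q, hpq]

lemma sac_injective (ψ : MvPolynomial (Fin 2) K →ₐ[K] MvPolynomial (Fin 2) K)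
    (h : IsSimpleAffineContraction ψ) : Function.Injective ψ := by
  rcases h with ⟨e, rfl⟩ | rfl
  · exact e.injective
  · exact tauX_injective

lemma sac_reach [CharZero K] (ψ : MvPolynomial (Fin 2) K →ₐ[K] MvPolynomial (Fin 2) K)
    (h : IsSimpleAffineContraction ψ) :
    Relation.ReflTransGen (ElemTrans (K := K)) (ψ (MvPolynomial.X 0), ψ (MvPolynomial.X 1)) (MvPolynomial.X 0, MvPolynomial.X 1) := by
  rcases h with ⟨e, rfl⟩ | rfl
  · refine jung _ _ _ ⟨e.symm (MvPolynomial.X 0), e.symm (MvPolynomial.X 1), ?_, ?_⟩ le_rfl <;>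
    · rw [← hom_aeval]
      have : (![MvPolynomial.X 0, MvPolynomial.X 1] : Fin 2 → MvPolynomial (Fin 2) K) =
        MvPolynomial.X := by ext1 i; fin_cases i <;> rfl
      rw [this, MvPolynomial.aeval_X_left]
      simp
  · refine .single ?_
    right; left
    refine ⟨0, 0, 1, ?_, ?_, ?_, ?_⟩ <;> simp [tauX, mul_comm]

lemma forward [CharZero K]
    (L : List (MvPolynomial (Fin 2) K →ₐ[K] MvPolynomial (Fin 2) K))
    (hL : ∀ ψ ∈ L, IsSimpleAffineContraction ψ) :
    Relation.ReflTransGen (ElemTrans (K := K)) ((L.foldr AlgHom.comp (AlgHom.id K (MvPolynomial (Fin 2) K))) (MvPolynomial.X 0),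
      (L.foldr AlgHom.comp (AlgHom.id K (MvPolynomial (Fin 2) K))) (MvPolynomial.X 1))
      (MvPolynomial.X 0, MvPolynomial.X 1) := by
  induction L with
  | nil => exact .refl
  | cons ψ L ih =>
    have h1 := ih (fun χ hχ => hL χ (List.mem_cons_of_mem _ hχ))
    have hψ := hL ψ List.mem_cons_self
    have h2 := Relation.ReflTransGen.lift (p := ElemTrans)
      (fun p : MvPolynomial (Fin 2) K × MvPolynomial (Fin 2) K => (ψ p.1, ψ p.2))
      (fun p p' h => ElemTrans_map ψ (sac_injective ψ hψ) p p' h) _ _ h1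
    exact Relation.ReflTransGen.trans h2 (sac_reach ψ hψ)

lemma foldr_append (L M : List (MvPolynomial (Fin 2) K →ₐ[K] MvPolynomial (Fin 2) K)) :
    (L ++ M).foldr AlgHom.comp (AlgHom.id K (MvPolynomial (Fin 2) K)) =
    (L.foldr AlgHom.comp (AlgHom.id K (MvPolynomial (Fin 2) K))).comp
      (M.foldr AlgHom.comp (AlgHom.id K (MvPolynomial (Fin 2) K))) := by
  induction L with
  | nil => rfl
  | cons ψ L ih => simp only [List.cons_append, List.foldr_cons, ih]; rfl

lemma prod_comp {φ ψ : MvPolynomial (Fin 2) K →ₐ[K] MvPolynomial (Fin 2) K}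
    (hφ : IsProdOfSAC φ) (hψ : IsProdOfSAC ψ) : IsProdOfSAC (φ.comp ψ) := by
  obtain ⟨L, hL, rfl⟩ := hφ
  obtain ⟨M, hM, rfl⟩ := hψ
  refine ⟨L ++ M, ?_, (foldr_append L M).symm⟩
  intro χ hχ
  rcases List.mem_append.mp hχ with h | h
  · exact hL χ h
  · exact hM χ h

lemma prod_single {ψ : MvPolynomial (Fin 2) K →ₐ[K] MvPolynomial (Fin 2) K}
    (h : IsSimpleAffineContraction ψ) : IsProdOfSAC ψ :=
  ⟨[ψ], by simpa using h, rfl⟩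

/-- an endomorphism with an inverse given by polynomials is a product -/
lemma prod_auto (f g f' g' : MvPolynomial (Fin 2) K)
    (h1 : MvPolynomial.aeval ![f, g] f' = MvPolynomial.X 0)
    (h2 : MvPolynomial.aeval ![f, g] g' = MvPolynomial.X 1)
    (h3 : MvPolynomial.aeval ![f', g'] f = MvPolynomial.X 0)
    (h4 : MvPolynomial.aeval ![f', g'] g = MvPolynomial.X 1) :
    IsProdOfSAC (MvPolynomial.aeval ![f, g] : MvPolynomial (Fin 2) K →ₐ[K] MvPolynomial (Fin 2) K) := by
  apply prod_single
  left
  refine ⟨AlgEquiv.ofAlgHom (MvPolynomial.aeval ![f, g]) (MvPolynomial.aeval ![f', g']) ?_ ?_, ?_⟩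
  · ext1 i; fin_cases i
    · simpa using! h1
    · simpa using! h2
  · ext1 i; fin_cases i
    · simpa using! h3
    · simpa using! h4
  · ext1 i; rfl

lemma aeval_pair_comp (u v f g : MvPolynomial (Fin 2) K) :
    (MvPolynomial.aeval ![u, v] : MvPolynomial (Fin 2) K →ₐ[K] MvPolynomial (Fin 2) K).comp
      (MvPolynomial.aeval ![f, g]) =
    MvPolynomial.aeval ![MvPolynomial.aeval ![u, v] f, MvPolynomial.aeval ![u, v] g] := by
  ext1 P; fin_cases P <;> simp

lemma prod_swap : IsProdOfSAC (MvPolynomial.aeval ![MvPolynomial.X 1, MvPolynomial.X 0] :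
    MvPolynomial (Fin 2) K →ₐ[K] MvPolynomial (Fin 2) K) := by
  apply prod_auto _ _ (MvPolynomial.X 1) (MvPolynomial.X 0) <;> simp

lemma prod_et1' (a b c : K) (h : c ≠ 0 ∨ b ≠ 0) :
    IsProdOfSAC (MvPolynomial.aeval ![MvPolynomial.X 0,
      MvPolynomial.X 1 * (MvPolynomial.C c * MvPolynomial.X 0 + MvPolynomial.C b) - MvPolynomial.C a] :
    MvPolynomial (Fin 2) K →ₐ[K] MvPolynomial (Fin 2) K) := by
  have hinv : ∀ c : K, c ≠ 0 → (MvPolynomial.C c : MvPolynomial (Fin 2) K) *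
      MvPolynomial.C c⁻¹ = 1 := by
    intro c hc; rw [← MvPolynomial.C_mul, mul_inv_cancel₀ hc, MvPolynomial.C_1]
  by_cases hc : c = 0
  · subst hc
    have hb : b ≠ 0 := by simpa using h
    have hb' := hinv b hb
    apply prod_auto _ _ (MvPolynomial.X 0)
      ((MvPolynomial.X 1 + MvPolynomial.C a) * MvPolynomial.C b⁻¹) <;>
      simp [MvPolynomial.algebraMap_eq]
    · linear_combination MvPolynomial.X 1 * hb'
    · linear_combination (MvPolynomial.X 1 + MvPolynomial.C a) * hb'
  · have hc' := hinv c hc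
    -- shift, then blow up, then unshift
    have s1 : IsProdOfSAC (MvPolynomial.aeval ![MvPolynomial.C c * MvPolynomial.X 0 + MvPolynomial.C b,
        MvPolynomial.X 1] : MvPolynomial (Fin 2) K →ₐ[K] MvPolynomial (Fin 2) K) := by
      apply prod_auto _ _ ((MvPolynomial.X 0 - MvPolynomial.C b) * MvPolynomial.C c⁻¹)
        (MvPolynomial.X 1) <;> simp [MvPolynomial.algebraMap_eq]
      · linear_combination MvPolynomial.X 0 * hc'
      · linear_combination (MvPolynomial.X 0 - MvPolynomial.C b) * hc'
    have s2 : IsProdOfSAC (tauX K) := prod_single (Or.inr rfl)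
    have s3 : IsProdOfSAC (MvPolynomial.aeval ![(MvPolynomial.X 0 - MvPolynomial.C b) * MvPolynomial.C c⁻¹,
        MvPolynomial.X 1 - MvPolynomial.C a] : MvPolynomial (Fin 2) K →ₐ[K] MvPolynomial (Fin 2) K) := by
      apply prod_auto _ _ (MvPolynomial.C c * MvPolynomial.X 0 + MvPolynomial.C b)
        (MvPolynomial.X 1 + MvPolynomial.C a) <;> simp [MvPolynomial.algebraMap_eq]
      · linear_combination (MvPolynomial.X 0 - MvPolynomial.C b) * hc'
      · linear_combination MvPolynomial.X 0 * hc'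
    convert prod_comp s1 (prod_comp s2 s3) using 1
    rw [tauX, aeval_pair_comp, aeval_pair_comp]
    ext1 i; fin_cases i
    · simp [MvPolynomial.algebraMap_eq]
      linear_combination -MvPolynomial.X 0 * hc'
    · simp [MvPolynomial.algebraMap_eq]
      ring

lemma prod_et2' (q : Polynomial K) :
    IsProdOfSAC (MvPolynomial.aeval ![MvPolynomial.X 0,
      MvPolynomial.X 1 - Polynomial.aeval (MvPolynomial.X 0) q] :
    MvPolynomial (Fin 2) K →ₐ[K] MvPolynomial (Fin 2) K) := by
  apply prod_auto _ _ (MvPolynomial.X 0)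
    (MvPolynomial.X 1 + Polynomial.aeval (MvPolynomial.X 0) q) <;>
    simp [← Polynomial.aeval_algHom_apply]

lemma prod_pair_swap {u v : MvPolynomial (Fin 2) K}
    (h : IsProdOfSAC (MvPolynomial.aeval ![u, v])) : IsProdOfSAC (MvPolynomial.aeval ![v, u]) := by
  have := prod_comp h prod_swap
  rw [aeval_pair_comp] at this
  simpa using this

lemma back_et1' {u v v' : MvPolynomial (Fin 2) K} (a b c : K)
    (h0 : MvPolynomial.C c * u + MvPolynomial.C b ≠ 0)
    (h1 : v' * (MvPolynomial.C c * u + MvPolynomial.C b) = v + MvPolynomial.C a)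
    (h : IsProdOfSAC (MvPolynomial.aeval ![u, v'])) : IsProdOfSAC (MvPolynomial.aeval ![u, v]) := by
  have hcb : c ≠ 0 ∨ b ≠ 0 := by
    by_contra hh
    push Not at hh
    apply h0; simp [hh.1, hh.2]
  have := prod_comp h (prod_et1' a b c hcb)
  rw [aeval_pair_comp] at this
  have e : v = v' * (MvPolynomial.C c * u + MvPolynomial.C b) - MvPolynomial.C a := by
    rw [h1]; ring
  rw [e]
  simpa [← MvPolynomial.algebraMap_eq] using this

lemma back_et2' {u v : MvPolynomial (Fin 2) K} (q : Polynomial K)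
    (h : IsProdOfSAC (MvPolynomial.aeval ![u, v + Polynomial.aeval u q])) :
    IsProdOfSAC (MvPolynomial.aeval ![u, v]) := by
  have := prod_comp h (prod_et2' q)
  rw [aeval_pair_comp] at this
  simpa [← Polynomial.aeval_algHom_apply] using this

lemma back (p p' : MvPolynomial (Fin 2) K × MvPolynomial (Fin 2) K) (h : ElemTrans p p')
    (hp : IsProdOfSAC (MvPolynomial.aeval ![p'.1, p'.2])) :
    IsProdOfSAC (MvPolynomial.aeval ![p.1, p.2]) := by
  rcases h with ⟨a, b, c, h1, h2, h3, h4⟩ | ⟨a, b, c, h1, h2, h3, h4⟩ | ⟨q, rfl⟩ | ⟨q, rfl⟩ | rfl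
  · rw [h4] at hp
    exact prod_pair_swap (back_et1' a b c h1 h3 (prod_pair_swap hp))
  · rw [h4] at hp
    exact back_et1' a b c h1 h3 hp
  · exact prod_pair_swap (back_et2' q (prod_pair_swap hp))
  · exact back_et2' q hp
  · exact prod_pair_swap hp

lemma backward (p : MvPolynomial (Fin 2) K × MvPolynomial (Fin 2) K)
    (h : Relation.ReflTransGen (ElemTrans (K := K)) p (MvPolynomial.X 0, MvPolynomial.X 1)) :
    IsProdOfSAC (MvPolynomial.aeval ![p.1, p.2]) := by
  induction h using Relation.ReflTransGen.head_induction_on with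
  | refl => apply prod_auto _ _ (MvPolynomial.X 0) (MvPolynomial.X 1) <;> simp
  | head h _ ih => exact back _ _ h ih

end jung

end SACProof

/-- A birational morphism `x ↦ u, y ↦ v` of the affine plane is a
composition of `K`-algebra automorphisms of `K[x,y]` and copies of `τ_x` if and only if
the pair `(u, v)` can be taken to `(x, y)` by a finite sequence of elementary
transformations (ET1)–(ET3). -/
theorem prodSAC_iff_elemTrans_to_xy {K : Type*} [Field K] [CharZero K]
    (u v : MvPolynomial (Fin 2) K)
    (hbir : IsBirationalPair u v) :
    IsProdOfSAC (MvPolynomial.aeval ![u, v]) ↔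
      Relation.ReflTransGen ElemTrans (u, v) (MvPolynomial.X 0, MvPolynomial.X 1) := by
  constructor
  · rintro ⟨L, hL, hφ⟩
    have h := SACProof.forward L hL
    rw [← hφ] at h
    simpa using h
  · intro h
    exact SACProof.backward (u, v) h
end

section
/- Set u = x⁴y² − 2x³y + x² + xy and v = x⁶y³ − 3x⁵y² + 3x⁴y + 2x³y² − x³ − 3x²y + x + y in ℂ[x,y]. Then the birational morphism x→u, y→v of A² over ℂ is not a product of simple affine contractions: the ℂ-algebra endomorphism φ of ℂ[x,y] with φ(x)=u, φ(y)=v is not a composition of finitely many maps each of which is either a ℂ-algebra automorphism of ℂ[x,y] or the map τ_x given by x→x, y→xy. -/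
lemma foldr_cases (L : List (MvPolynomial (Fin 2) ℂ →ₐ[ℂ] MvPolynomial (Fin 2) ℂ))
    (h : ∀ ψ ∈ L, IsSimpleAffineContraction ψ) :
    Function.Surjective (L.foldr AlgHom.comp (AlgHom.id ℂ (MvPolynomial (Fin 2) ℂ)) :
      MvPolynomial (Fin 2) ℂ →ₐ[ℂ] MvPolynomial (Fin 2) ℂ) ∨
    ∃ (e : MvPolynomial (Fin 2) ℂ ≃ₐ[ℂ] MvPolynomial (Fin 2) ℂ)
      (ψ : MvPolynomial (Fin 2) ℂ →ₐ[ℂ] MvPolynomial (Fin 2) ℂ),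
      ∀ f, (L.foldr AlgHom.comp (AlgHom.id ℂ (MvPolynomial (Fin 2) ℂ)) :
        MvPolynomial (Fin 2) ℂ →ₐ[ℂ] MvPolynomial (Fin 2) ℂ) f
        = e (tauX ℂ (ψ f)) := by
  induction L with
  | nil => left; intro a; exact ⟨a, rfl⟩
  | cons a L ih =>
    have ih := ih (fun ψ hψ => h ψ (List.mem_cons_of_mem _ hψ))
    rcases h a List.mem_cons_self with ⟨e', rfl⟩ | rfl
    · rcases ih with hs | ⟨e, ψ, he⟩
      · left
        intro b
        obtain ⟨c, hc⟩ := hs (e'.symm b)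
        exact ⟨c, by simp [hc]⟩
      · right
        exact ⟨e.trans e', ψ, fun f => by simp [he]⟩
    · right
      exact ⟨AlgEquiv.refl, _, fun f => rfl⟩

lemma tau_const (f : MvPolynomial (Fin 2) ℂ) :
    MvPolynomial.aeval ![(0 : Polynomial ℂ), Polynomial.X] (tauX ℂ f)
      = Polynomial.C (MvPolynomial.eval (fun _ => 0) f) := by
  induction f using MvPolynomial.induction_on with
  | C a => simp [tauX]
  | add p q hp hq => simp only [map_add, hp, hq]
  | mul_X p i hp =>
    rw [map_mul, map_mul, hp]
    fin_cases i <;> simp [tauX]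

open Polynomial in
lemma const_of_eq (p q : Polynomial ℂ) (a b : ℂ)
    (hu : p ^ 4 * q ^ 2 - 2 * p ^ 3 * q + p ^ 2 + p * q = C a)
    (hv : p ^ 6 * q ^ 3 - 3 * p ^ 5 * q ^ 2 + 3 * p ^ 4 * q
          + 2 * p ^ 3 * q ^ 2 - p ^ 3 - 3 * p ^ 2 * q + p + q = C b) :
    p.natDegree = 0 ∧ q.natDegree = 0 := by
  by_cases hp : p = 0
  · subst hp
    have : q = C b := by rw [← hv]; ring
    subst this
    simp
  by_cases hq : q = 0
  · subst hq
    have h : p ^ 2 = C a := by rw [← hu]; ring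
    have h2 := congrArg natDegree h
    rw [natDegree_pow, natDegree_C] at h2
    exact ⟨by omega, by simp⟩
  have hd : (p * q).natDegree = p.natDegree + q.natDegree := natDegree_mul hp hq
  by_contra hne
  have hpos : 0 < (p * q).natDegree := by omega
  have h1 : (1 - p * q).natDegree = (p * q).natDegree := by
    rw [natDegree_sub]
    rw [show (1 : Polynomial ℂ) = C 1 from rfl, natDegree_sub_C]
  have h0 : 1 - p * q ≠ 0 := by
    intro h; rw [h] at h1; simp at h1; omega
  have h2 : (p * (1 - p * q)) ^ 2 = C a - p * q := by rw [← hu]; ring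
  have h3 := congrArg natDegree h2
  rw [natDegree_pow, natDegree_mul hp h0, h1, natDegree_sub, natDegree_sub_C] at h3
  omega

open MvPolynomial in
/-- For `u = x⁴y² − 2x³y + x² + xy` and
`v = x⁶y³ − 3x⁵y² + 3x⁴y + 2x³y² − x³ − 3x²y + x + y` in `ℂ[x,y]`, the birational
morphism `x ↦ u, y ↦ v` is not a product of simple affine contractions. -/
theorem cassou_nogues_russell_not_prodSAC :
    ¬ IsProdOfSAC (MvPolynomial.aeval
      ![X 0 ^ 4 * X 1 ^ 2 - 2 * X 0 ^ 3 * X 1 + X 0 ^ 2 + X 0 * X 1,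
        X 0 ^ 6 * X 1 ^ 3 - 3 * X 0 ^ 5 * X 1 ^ 2 + 3 * X 0 ^ 4 * X 1
          + 2 * X 0 ^ 3 * X 1 ^ 2 - X 0 ^ 3 - 3 * X 0 ^ 2 * X 1 + X 0 + X 1] :
        MvPolynomial (Fin 2) ℂ →ₐ[ℂ] MvPolynomial (Fin 2) ℂ) := by
  rintro ⟨L, hL, hφ⟩
  rcases foldr_cases L hL with hs | ⟨e, ψ, he⟩
  · rw [← hφ] at hs
    obtain ⟨f, hf⟩ := hs (X 0)
    have key : ∀ (P : Fin 2 → ℂ), (∀ i, eval P ((![X 0 ^ 4 * X 1 ^ 2 - 2 * X 0 ^ 3 * X 1 + X 0 ^ 2 + X 0 * X 1,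
        X 0 ^ 6 * X 1 ^ 3 - 3 * X 0 ^ 5 * X 1 ^ 2 + 3 * X 0 ^ 4 * X 1
          + 2 * X 0 ^ 3 * X 1 ^ 2 - X 0 ^ 3 - 3 * X 0 ^ 2 * X 1 + X 0 + X 1] :
          Fin 2 → MvPolynomial (Fin 2) ℂ) i) = 0) → P 0 = eval (fun _ => 0) f := by
      intro P hP
      have h := congrArg (eval P) hf
      rw [eval_X] at h
      rw [← h, aeval_def, ← coe_eval₂Hom, ← RingHom.comp_apply]
      congr 1
      ext i
      · simp
      · simpa using hP i
    have k1 := key ![0, 0] (by intro i; fin_cases i <;> simp)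
    have k2 := key ![1/2, -2] (by intro i; fin_cases i <;> simp <;> norm_num)
    rw [← k1] at k2
    simp at k2
  · rw [← hφ] at he
    let γ : MvPolynomial (Fin 2) ℂ →ₐ[ℂ] Polynomial ℂ :=
      (aeval ![(0 : Polynomial ℂ), Polynomial.X]).comp (e.symm : _ →ₐ[ℂ] _)
    have hγ : ∀ f, γ (e (tauX ℂ (ψ f))) = Polynomial.C (eval (fun _ => 0) (ψ f)) := by
      intro f
      rw [← tau_const]
      simp [γ]
    have hu := hγ (X 0)
    have hv := hγ (X 1)
    rw [← he] at hu hv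
    simp only [aeval_X, Matrix.cons_val_zero, Matrix.cons_val_one, map_add, map_sub, map_mul,
      map_pow, map_ofNat] at hu hv
    obtain ⟨hp, hq⟩ := const_of_eq _ _ _ _ hu hv
    have hall : ∀ f, (γ f).natDegree = 0 := by
      intro f
      induction f using MvPolynomial.induction_on with
      | C a =>
        have : γ (C a) = Polynomial.C a := γ.commutes a
        rw [this]; simp
      | add p q hp hq =>
        rw [map_add]
        have := Polynomial.natDegree_add_le (γ p) (γ q)
        simp only [hp, hq] at this
        simpa using this
      | mul_X p i hpp =>
        rw [map_mul]
        have := Polynomial.natDegree_mul_le (p := γ p) (q := γ (X i))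
        have hi : (γ (X i)).natDegree = 0 := by fin_cases i <;> assumption
        omega
    have hX : γ (e (X 1)) = Polynomial.X := by simp [γ]
    have := hall (e (X 1))
    rw [hX] at this
    simp at this
end

section
/- There exists a birational morphism of the affine plane A² over ℂ that is not a product of simple affine contractions: there exist u, v ∈ ℂ[x,y] such that the subfield ℂ(u,v) of ℂ(x,y) generated over ℂ by u and v equals ℂ(x,y), yet the ℂ-algebra endomorphism φ of ℂ[x,y] with φ(x)=u, φ(y)=v is not a composition of finitely many maps each of which is either a ℂ-algebra automorphism of ℂ[x,y] or the map τ_x given by x→x, y→xy. -/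
/-- A product of simple affine contractions is bijective or contracts a polynomial curve. -/
theorem prodSAC_dichotomy
    (L : List (MvPolynomial (Fin 2) ℂ →ₐ[ℂ] MvPolynomial (Fin 2) ℂ))
    (hL : ∀ ψ ∈ L, IsSimpleAffineContraction ψ) :
    Function.Surjective (L.foldr AlgHom.comp (AlgHom.id ℂ (MvPolynomial (Fin 2) ℂ)) :
      MvPolynomial (Fin 2) ℂ →ₐ[ℂ] MvPolynomial (Fin 2) ℂ) ∨
    ∃ g : MvPolynomial (Fin 2) ℂ →ₐ[ℂ] Polynomial ℂ, Function.Surjective g ∧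
      ∀ f, ∃ c : ℂ, g ((L.foldr AlgHom.comp (AlgHom.id ℂ (MvPolynomial (Fin 2) ℂ)) :
      MvPolynomial (Fin 2) ℂ →ₐ[ℂ] MvPolynomial (Fin 2) ℂ) f)
        = Polynomial.C c := by
  induction L with
  | nil => left; intro f; exact ⟨f, rfl⟩
  | cons ψ L ih =>
    rcases hL ψ (by simp) with ⟨e, rfl⟩ | rfl
    · rcases ih (fun χ hχ => hL χ (by simp [hχ])) with h | ⟨g, hg, h⟩
      · left
        simp only [List.foldr_cons, AlgHom.coe_comp]
        exact e.surjective.comp h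
      · right
        refine ⟨g.comp (e.symm : MvPolynomial (Fin 2) ℂ →ₐ[ℂ] MvPolynomial (Fin 2) ℂ), ?_, ?_⟩
        · simp only [AlgHom.coe_comp]
          exact hg.comp e.symm.surjective
        · intro f
          obtain ⟨c, hc⟩ := h f
          exact ⟨c, by simpa using hc⟩
    · right
      refine ⟨MvPolynomial.aeval ![0, Polynomial.X], ?_, ?_⟩
      · intro p
        refine ⟨Polynomial.aeval (MvPolynomial.X 1) p, ?_⟩
        rw [← Polynomial.aeval_algHom_apply]
        simp
      · intro f
        simp only [List.foldr_cons, AlgHom.comp_apply]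
        generalize (L.foldr AlgHom.comp (AlgHom.id ℂ (MvPolynomial (Fin 2) ℂ)) :
          MvPolynomial (Fin 2) ℂ →ₐ[ℂ] MvPolynomial (Fin 2) ℂ) f = q
        refine ⟨MvPolynomial.eval ![0, 0] q, ?_⟩
        have : ((MvPolynomial.aeval ![0, Polynomial.X] :
              MvPolynomial (Fin 2) ℂ →ₐ[ℂ] Polynomial ℂ).comp (tauX ℂ)) =
            (Algebra.ofId ℂ (Polynomial ℂ)).comp
              (MvPolynomial.aeval ![0, 0] : MvPolynomial (Fin 2) ℂ →ₐ[ℂ] ℂ) := by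
          apply MvPolynomial.algHom_ext
          intro i
          fin_cases i <;> simp [tauX]
        have h2 := DFunLike.congr_fun this q
        simpa [AlgHom.comp_apply, Algebra.ofId_apply, MvPolynomial.aeval_eq_eval] using h2

/-- Two polynomials in one variable with nonzero constant product are constant. -/
theorem const_of_mul {p q : Polynomial ℂ} {c : ℂ} (hc : c ≠ 0) (h : p * q = Polynomial.C c) :
    ∃ a : ℂ, a ≠ 0 ∧ p = Polynomial.C a := by
  have hu : IsUnit (p * q) := by
    rw [h]; exact Polynomial.isUnit_C.2 hc.isUnit
  obtain ⟨a, ha, hp⟩ := Polynomial.isUnit_iff.1 (isUnit_of_mul_isUnit_left hu)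
  exact ⟨a, ha.ne_zero, hp.symm⟩

/-- From `C a * q = C b` with `a ≠ 0`, `q` is constant. -/
theorem const_of_C_mul {q : Polynomial ℂ} {a b : ℂ} (ha : a ≠ 0)
    (h : Polynomial.C a * q = Polynomial.C b) : q = Polynomial.C (b / a) := by
  apply mul_left_cancel₀ (Polynomial.C_ne_zero.2 ha)
  rw [h, ← Polynomial.C_mul, mul_div_cancel₀ _ ha]

/-- If the square of `p` is constant then so is `p`. -/
theorem const_of_sq {p : Polynomial ℂ} {c : ℂ} (h : p ^ 2 = Polynomial.C c) :
    ∃ a : ℂ, p = Polynomial.C a := by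
  have h1 := congrArg Polynomial.natDegree h
  rw [Polynomial.natDegree_pow, Polynomial.natDegree_C] at h1
  exact ⟨_, Polynomial.eq_C_of_natDegree_eq_zero (by omega)⟩

/-- The morphism contracts no nonconstant polynomial curve. -/
theorem no_contracted (x y : Polynomial ℂ) (a b : ℂ)
    (hu : x * (y + x * (1 + x * y) ^ 2) = Polynomial.C a)
    (hv : (y + x * (1 + x * y) ^ 2) * (1 + x ^ 2 * (1 + x * y)) = Polynomial.C b) :
    (∃ c, x = Polynomial.C c) ∧ ∃ d, y = Polynomial.C d := by
  by_cases hb : b = 0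
  · rw [hb, Polynomial.C_0] at hv
    rcases mul_eq_zero.1 hv with h | h
    · have h1 : (1 + x * y) * (1 + x ^ 2 * (1 + x * y)) = Polynomial.C 1 := by
        rw [Polynomial.C_1]; linear_combination x * h
      obtain ⟨B, hB, hBe⟩ := const_of_mul one_ne_zero h1
      have h2 : Polynomial.C (B ^ 2) * x ^ 2 = Polynomial.C (1 - B) := by
        simp only [Polynomial.C_pow, Polynomial.C_sub, Polynomial.C_1]
        rw [hBe, Polynomial.C_1] at h1
        linear_combination h1
      obtain ⟨A, hA⟩ := const_of_sq (const_of_C_mul (pow_ne_zero 2 hB) h2)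
      refine ⟨⟨A, hA⟩, -(A * B ^ 2), ?_⟩
      rw [hBe, hA] at h
      simp only [Polynomial.C_neg, Polynomial.C_mul, Polynomial.C_pow]
      linear_combination h
    · have h1 : x * (x * (1 + x * y)) = Polynomial.C (-1) := by
        rw [Polynomial.C_neg, Polynomial.C_1]; linear_combination h
      obtain ⟨A, hA, hAe⟩ := const_of_mul (by norm_num) h1
      refine ⟨⟨A, hAe⟩, _, const_of_C_mul (a := A ^ 3) (b := -1 - A ^ 2) (pow_ne_zero 3 hA) ?_⟩
      rw [hAe] at h
      simp only [Polynomial.C_sub, Polynomial.C_neg, Polynomial.C_pow, Polynomial.C_1]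
      linear_combination h
  · obtain ⟨P, hP, hPe⟩ := const_of_mul hb hv
    rw [hPe] at hu
    have hx := const_of_C_mul hP (by rw [mul_comm]; exact hu)
    obtain ⟨Q, hQ, hQe⟩ := const_of_mul hb (by rw [mul_comm]; exact hv)
    have h1 : Polynomial.C Q * (1 + x * y) = Polynomial.C (a + 1) := by
      rw [← hQe, Polynomial.C_add, ← hu, ← hPe, Polynomial.C_1]; ring
    have h2 := const_of_C_mul hQ h1
    refine ⟨⟨_, hx⟩, P - (a / P) * ((a + 1) / Q) ^ 2, ?_⟩
    rw [h2, hx] at hPe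
    rw [Polynomial.C_sub, Polynomial.C_mul, Polynomial.C_pow]
    linear_combination hPe

/-- The first coordinate of the example. -/
noncomputable def exU : MvPolynomial (Fin 2) ℂ :=
  .X 0 * (.X 1 + .X 0 * (1 + .X 0 * .X 1) ^ 2)

/-- The second coordinate of the example. -/
noncomputable def exV : MvPolynomial (Fin 2) ℂ :=
  (.X 1 + .X 0 * (1 + .X 0 * .X 1) ^ 2) * (1 + .X 0 ^ 2 * (1 + .X 0 * .X 1))

theorem ex_birational : IsBirationalPair exU exV := by
  unfold IsBirationalPair
  set F := FractionRing (MvPolynomial (Fin 2) ℂ)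
  set ι := algebraMap (MvPolynomial (Fin 2) ℂ) F with hι
  set S := IntermediateField.adjoin ℂ {ι exU, ι exV} with hS
  have hinj : Function.Injective ι := IsFractionRing.injective _ _
  have hu : ι exU ∈ S := IntermediateField.subset_adjoin _ _ (by simp)
  have hv : ι exV ∈ S := IntermediateField.subset_adjoin _ _ (by simp)
  set x : F := ι (.X 0) with hx
  set y : F := ι (.X 1) with hy
  have eu : ι exU = x * (y + x * (1 + x * y) ^ 2) := by simp [exU, hx, hy]
  have ev : ι exV = (y + x * (1 + x * y) ^ 2) * (1 + x ^ 2 * (1 + x * y)) := by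
    simp [exV, hx, hy]
  have x0 : x ≠ 0 := by
    rw [hx, Ne, map_eq_zero_iff ι hinj]; exact MvPolynomial.X_ne_zero 0
  have p0 : y + x * (1 + x * y) ^ 2 ≠ 0 := by
    have : y + x * (1 + x * y) ^ 2 = ι (.X 1 + .X 0 * (1 + .X 0 * .X 1) ^ 2) := by
      simp [hx, hy]
    rw [this, Ne, map_eq_zero_iff ι hinj]
    intro h
    have := congrArg (MvPolynomial.eval ![(0 : ℂ), 1]) h
    simp at this
  have q0 : 1 + x ^ 2 * (1 + x * y) ≠ 0 := by
    have : 1 + x ^ 2 * (1 + x * y) = ι (1 + .X 0 ^ 2 * (1 + .X 0 * .X 1)) := by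
      simp [hx, hy]
    rw [this, Ne, map_eq_zero_iff ι hinj]
    intro h
    have := congrArg (MvPolynomial.eval ![(0 : ℂ), 1]) h
    simp at this
  rw [eu] at hu
  rw [ev] at hv
  generalize hp : y + x * (1 + x * y) ^ 2 = p at *
  generalize hq : 1 + x ^ 2 * (1 + x * y) = q at *
  have hpS : p ∈ S := by
    have : p = ((p * q) ^ 2 - (x * p) ^ 2 * (x * p + 1)) / (p * q) := by
      rw [eq_div_iff (mul_ne_zero p0 q0)]
      have h1 : x * p + 1 = (1 + x * y) * q := by rw [← hp, ← hq]; ring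
      rw [h1]
      have h2 : q = 1 + x ^ 2 * (1 + x * y) := hq.symm
      linear_combination (-p ^ 2 * q) * h2
    rw [this]
    exact S.div_mem (S.sub_mem (S.pow_mem hv 2)
      (S.mul_mem (S.pow_mem hu 2) (S.add_mem hu S.one_mem))) hv
  have hxS : x ∈ S := by
    have := S.div_mem hu hpS
    rwa [mul_div_cancel_right₀ _ p0] at this
  have hqS : q ∈ S := by
    have := S.div_mem hv hpS
    rwa [mul_div_cancel_left₀ _ p0] at this
  have hyS : y ∈ S := by
    have : y = (q - 1 - x ^ 2) / x ^ 3 := by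
      rw [eq_div_iff (pow_ne_zero 3 x0), ← hq]; ring
    rw [this]
    exact S.div_mem (S.sub_mem (S.sub_mem hqS S.one_mem) (S.pow_mem hxS 2)) (S.pow_mem hxS 3)
  have hall : ∀ f : MvPolynomial (Fin 2) ℂ, ι f ∈ S := by
    intro f
    induction f using MvPolynomial.induction_on with
    | C a =>
      have : ι (MvPolynomial.C a) = algebraMap ℂ F a := by
        rw [hι, ← MvPolynomial.algebraMap_eq, ← IsScalarTower.algebraMap_apply]
      rw [this]; exact S.algebraMap_mem a
    | add p q hp hq => rw [map_add]; exact S.add_mem hp hq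
    | mul_X p i hp =>
      rw [map_mul]
      refine S.mul_mem hp ?_
      fin_cases i
      · exact hxS
      · exact hyS
  rw [eq_top_iff]
  intro z _
  obtain ⟨f, g, -, rfl⟩ := IsFractionRing.div_surjective (A := MvPolynomial (Fin 2) ℂ) z
  exact S.div_mem (hall f) (hall g)

theorem ex_not_surjective :
    ¬ Function.Surjective (MvPolynomial.aeval ![exU, exV] :
          MvPolynomial (Fin 2) ℂ →ₐ[ℂ] MvPolynomial (Fin 2) ℂ) := by
  intro h
  obtain ⟨f, hf⟩ := h (.X 0)
  have key : (MvPolynomial.aeval ![(0 : ℂ), 0] : MvPolynomial (Fin 2) ℂ →ₐ[ℂ] ℂ).comp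
        (MvPolynomial.aeval ![exU, exV]) =
      (MvPolynomial.aeval ![(2 / 3 : ℂ), -6] : MvPolynomial (Fin 2) ℂ →ₐ[ℂ] ℂ).comp
        (MvPolynomial.aeval ![exU, exV]) := by
    apply MvPolynomial.algHom_ext
    intro i
    fin_cases i <;> simp [exU, exV] <;> norm_num
  have h2 := DFunLike.congr_fun key f
  rw [AlgHom.comp_apply, AlgHom.comp_apply, hf] at h2
  norm_num at h2

/-- There exists a birational morphism of the affine plane over `ℂ`
that is not a product of simple affine contractions. -/
theorem exists_birational_not_prodSAC :
    ∃ u v : MvPolynomial (Fin 2) ℂ,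
      IsBirationalPair u v ∧
      ¬ IsProdOfSAC (MvPolynomial.aeval ![u, v] :
          MvPolynomial (Fin 2) ℂ →ₐ[ℂ] MvPolynomial (Fin 2) ℂ) := by
  refine ⟨exU, exV, ex_birational, ?_⟩
  rintro ⟨L, hL, hφ⟩
  rcases prodSAC_dichotomy L hL with h | ⟨g, hg, h⟩
  · rw [← hφ] at h
    exact ex_not_surjective h
  · rw [← hφ] at h
    obtain ⟨a, ha⟩ := h (.X 0)
    obtain ⟨b, hb⟩ := h (.X 1)
    simp only [MvPolynomial.aeval_X, Matrix.cons_val_zero, Matrix.cons_val_one] at ha hb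
    obtain ⟨⟨c, hc⟩, d, hd⟩ := no_contracted (g (.X 0)) (g (.X 1)) a b
      (by rw [← ha]; simp [exU]) (by rw [← hb]; simp [exV])
    have key : g = (Algebra.ofId ℂ (Polynomial ℂ)).comp
        (MvPolynomial.aeval ![c, d] : MvPolynomial (Fin 2) ℂ →ₐ[ℂ] ℂ) := by
      apply MvPolynomial.algHom_ext
      intro i
      fin_cases i
      · simpa [Algebra.ofId_apply] using hc
      · simpa [Algebra.ofId_apply] using hd
    obtain ⟨f, hf⟩ := hg Polynomial.X
    rw [key, AlgHom.comp_apply, Algebra.ofId_apply, Polynomial.algebraMap_eq] at hf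
    have := congrArg Polynomial.natDegree hf
    simp at this
end
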